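/- arXiv:2104.10314 — 6 statements merged into one kernel-verified Lean document; each statement's English description precedes it below -/
import Mathlib

section
/- Let x ∈ ℝ^N be a Bernoulli–Gaussian random vector with parameter θ ∈ (0,1) and let Ω denote its random support. Then for every d on the unit sphere S^{N−1} and every integer p ≥ 2, 𝔼[|dᵀx|^p] = γ_p · 𝔼_Ω[‖d_Ω‖^p] ≤ γ_p · θ, where d_Ω denotes the restriction of d to the coordinates in Ω and ‖·‖ is the Euclidean norm. -/
open MeasureTheory ProbabilityTheory Real

/-- The Bernoulli–Gaussian distribution BG(θ) on ℝ: with probability 1−θ it is 0,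
with probability θ it is a standard Gaussian (the law of b·g, b ~ Ber(θ), g ~ N(0,1)). -/
noncomputable def bgMeasure (θ : ℝ) : Measure ℝ :=
  (1 - θ).toNNReal • Measure.dirac 0 + θ.toNNReal • gaussianReal 0 1

instance (θ : ℝ) : IsFiniteMeasure (bgMeasure θ) := by
  unfold bgMeasure; infer_instance

/-- The law of a Bernoulli–Gaussian random vector x ∈ ℝ^N with i.i.d. BG(θ) coordinates. -/
noncomputable def bgPi (θ : ℝ) (N : ℕ) : Measure (Fin N → ℝ) :=
  Measure.pi fun _ => bgMeasure θ

/-- γ_p = 2^{p/2} Γ((p+1)/2)/√π, the p-th absolute moment of a standard Gaussian. -/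
noncomputable def gammaMom (p : ℕ) : ℝ :=
  Real.sqrt 2 ^ p * Real.Gamma (((p : ℝ) + 1) / 2) / Real.sqrt π

lemma absMom_std (p : ℕ) : ∫ x, |x| ^ p ∂ gaussianReal 0 1 = gammaMom p := by
  rw [integral_gaussianReal_eq_integral_smul one_ne_zero]
  have h1 : ∀ x : ℝ, gaussianPDFReal 0 1 x • |x| ^ p
      = (fun y : ℝ => (√(2 * π))⁻¹ * (y ^ (p : ℝ) * rexp (-(1 / 2) * y ^ (2 : ℝ)))) |x| := by
    intro x
    simp only [gaussianPDFReal, smul_eq_mul, Real.rpow_natCast, Real.rpow_two, sq_abs]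
    simp only [NNReal.coe_one, mul_one, sub_zero]
    rw [show -x ^ 2 / 2 = -(1 / 2) * x ^ 2 by ring]
    ring
  simp_rw [h1]
  rw [integral_comp_abs (f := fun y : ℝ => (√(2 * π))⁻¹ * (y ^ (p : ℝ) * rexp (-(1 / 2) * y ^ (2 : ℝ)))),
    integral_const_mul,
    integral_rpow_mul_exp_neg_mul_rpow (by norm_num) (by have : (0 : ℝ) ≤ p := p.cast_nonneg
                                                         linarith) (by norm_num)]
  unfold gammaMom
  have h2 : (1 / 2 : ℝ) ^ (-((p : ℝ) + 1) / 2) = √2 ^ p * √2 := by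
    rw [← pow_succ, one_div, Real.inv_rpow (by norm_num), ← Real.rpow_neg (by norm_num),
      Real.sqrt_eq_rpow, ← Real.rpow_natCast, ← Real.rpow_mul (by norm_num)]
    congr 1
    push_cast
    ring
  rw [h2, Real.sqrt_mul (by norm_num)]
  have h3 : √2 ≠ 0 := by positivity
  have h4 : √π ≠ 0 := by positivity
  field_simp

lemma absMom (v : NNReal) (p : ℕ) :
    ∫ x, |x| ^ p ∂ gaussianReal 0 v = gammaMom p * √(v : ℝ) ^ p := by
  have h := gaussianReal_map_const_mul (μ := 0) (v := 1) (√(v : ℝ))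
  have h' : gaussianReal 0 v = (gaussianReal 0 1).map (√(v : ℝ) * ·) := by
    rw [h]
    congr 1
    · simp
    · ext
      simp
  rw [h', integral_map (by fun_prop) (by fun_prop)]
  simp_rw [abs_mul, mul_pow, abs_of_nonneg (Real.sqrt_nonneg (v : ℝ))]
  rw [integral_const_mul, absMom_std, mul_comm]

lemma absMom_integrable (v : NNReal) (p : ℕ) :
    Integrable (fun x : ℝ => |x| ^ p) (gaussianReal 0 v) := by
  have h := (memLp_id_gaussianReal (μ := 0) (v := v) p)
  have := h.integrable_norm_pow'
  simpa using this

/-- the mixture of Gaussians -/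
noncomputable def mixG (θ : ℝ) (N : ℕ) (d : Fin N → ℝ) : Measure ℝ :=
  ∑ S : Finset (Fin N), (θ ^ S.card * (1 - θ) ^ (N - S.card)).toNNReal •
    gaussianReal 0 (∑ i ∈ S, d i ^ 2).toNNReal

instance (θ : ℝ) (N : ℕ) (d : Fin N → ℝ) : IsFiniteMeasure (mixG θ N d) := by
  unfold mixG; infer_instance

lemma int_mixG {E : Type*} [NormedAddCommGroup E] [NormedSpace ℝ E] {θ : ℝ} (hθ : θ ∈ Set.Ioo (0 : ℝ) 1) (N : ℕ) (d : Fin N → ℝ) (f : ℝ → E)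
    (hf : ∀ v, Integrable f (gaussianReal 0 v)) :
    ∫ x, f x ∂ mixG θ N d = ∑ S : Finset (Fin N), (θ ^ S.card * (1 - θ) ^ (N - S.card)) •
      ∫ x, f x ∂ gaussianReal 0 (∑ i ∈ S, d i ^ 2).toNNReal := by
  unfold mixG
  rw [integral_finsetSum_measure (fun S _ => (hf _).smul_measure_nnreal)]
  refine Finset.sum_congr rfl fun S _ => ?_
  rw [integral_smul_nnreal_measure, NNReal.smul_def, Real.coe_toNNReal]
  have := hθ.1
  have : 0 < 1 - θ := by linarith [hθ.2]
  positivity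

lemma map_eq {θ : ℝ} (hθ : θ ∈ Set.Ioo (0 : ℝ) 1) (N : ℕ) (d : Fin N → ℝ) :
    (bgPi θ N).map (fun x => ∑ i, d i * x i) = mixG θ N d := by
  have : IsFiniteMeasure (bgPi θ N) := by unfold bgPi; infer_instance
  have h1 : 0 < 1 - θ := by linarith [hθ.2]
  have hint : ∀ (s : ℝ) (μ : Measure ℝ) [IsFiniteMeasure μ],
      Integrable (fun x : ℝ => Complex.exp (s * x * Complex.I)) μ := by
    intro s μ _
    refine Integrable.of_bound (by fun_prop) 1 (.of_forall fun x => ?_)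
    rw [← Complex.ofReal_mul, Complex.norm_exp_ofReal_mul_I]
  have hone : ∀ s : ℝ, ∫ x, Complex.exp (s * x * Complex.I) ∂ bgMeasure θ
      = θ * Complex.exp (-(s ^ 2 / 2 : ℝ)) + (1 - θ : ℝ) := by
    intro s
    unfold bgMeasure
    rw [integral_add_measure (hint s _) (hint s _), integral_smul_nnreal_measure,
      integral_smul_nnreal_measure, NNReal.smul_def, NNReal.smul_def,
      Real.coe_toNNReal _ h1.le, Real.coe_toNNReal _ hθ.1.le, integral_dirac,
      ← charFun_apply_real, charFun_gaussianReal, add_comm]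
    simp
  apply Measure.ext_of_charFun
  funext t
  rw [charFun_apply_real, charFun_apply_real,
    integral_map (Measurable.aemeasurable (by fun_prop)) (by fun_prop),
    int_mixG hθ N d _ (fun v => hint t _)]
  have h2 : ∀ x : Fin N → ℝ, Complex.exp (t * (∑ i, d i * x i : ℝ) * Complex.I)
      = ∏ i, (fun i (y : ℝ) => Complex.exp ((t * d i : ℝ) * y * Complex.I)) i (x i) := by
    intro x
    simp only
    rw [← Complex.exp_sum]
    congr 1
    push_cast
    rw [Finset.mul_sum, Finset.sum_mul]
    exact Finset.sum_congr rfl fun i _ => by ring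
  simp_rw [h2]
  unfold bgPi
  rw [integral_fintype_prod_eq_prod
    (f := fun i (y : ℝ) => Complex.exp ((t * d i : ℝ) * y * Complex.I))]
  simp_rw [hone]
  rw [Fintype.prod_add]
  refine Finset.sum_congr rfl fun S _ => ?_
  rw [← charFun_apply_real, charFun_gaussianReal, Finset.prod_mul_distrib, ← Complex.exp_sum,
    Finset.prod_const, Finset.prod_const, Finset.card_compl, Fintype.card_fin,
    Real.coe_toNNReal _ (Finset.sum_nonneg fun i _ => sq_nonneg _), Complex.real_smul]
  have h3 : ∑ i ∈ S, (-((((t * d i) ^ 2 / 2 : ℝ)) : ℂ))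
      = t * (0 : ℝ) * Complex.I - ((∑ i ∈ S, d i ^ 2 : ℝ) : ℂ) * t ^ 2 / 2 := by
    push_cast
    rw [Finset.sum_neg_distrib, Finset.sum_mul, Finset.sum_div]
    simp only [mul_zero, zero_mul, zero_sub, neg_inj]
    exact Finset.sum_congr rfl fun i _ => by ring
  rw [h3]
  push_cast
  ring

lemma weight_mem {θ : ℝ} (N : ℕ) (i : Fin N) :
    ∑ S : Finset (Fin N), (θ ^ S.card * (1 - θ) ^ (N - S.card) * if i ∈ S then 1 else 0) = θ := by
  have h := Fintype.prod_add (fun _ : Fin N => θ) (fun j => if j = i then 0 else 1 - θ)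
  have h1 : ∏ j : Fin N, (θ + if j = i then 0 else 1 - θ) = θ := by
    rw [Finset.prod_eq_single i] <;> simp +contextual
  rw [h1] at h
  conv_rhs => rw [h]
  refine Finset.sum_congr rfl fun S _ => ?_
  rw [Finset.prod_const]
  by_cases hi : i ∈ S
  · rw [Finset.prod_congr rfl (g := fun _ => 1 - θ), Finset.prod_const, Finset.card_compl,
      Fintype.card_fin]
    · simp [hi]
    · intro j hj
      have : j ≠ i := by rintro rfl; simp at hj; exact hj hi
      simp [this]
  · rw [Finset.prod_eq_zero (i := i) (by simpa using hi) (by simp)]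
    simp [hi]

/-- For x ~ BG(θ), d on the unit sphere and integer p ≥ 2,
𝔼[|dᵀx|^p] = γ_p · 𝔼_Ω[‖d_Ω‖^p] ≤ γ_p · θ, where the expectation over the random
support Ω is the sum over subsets S of θ^{|S|}(1−θ)^{N−|S|}‖d_S‖^p. -/
theorem stmt2 (N : ℕ) (θ : ℝ) (hθ : θ ∈ Set.Ioo (0 : ℝ) 1)
    (d : Fin N → ℝ) (hd : ∑ i, d i ^ 2 = 1) (p : ℕ) (hp : 2 ≤ p) :
    (∫ x, |∑ i, d i * x i| ^ p ∂ bgPi θ N) =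
      gammaMom p * ∑ S : Finset (Fin N),
        θ ^ S.card * (1 - θ) ^ (N - S.card) * Real.sqrt (∑ i ∈ S, d i ^ 2) ^ p ∧
    (∫ x, |∑ i, d i * x i| ^ p ∂ bgPi θ N) ≤ gammaMom p * θ := by
  have key : (∫ x, |∑ i, d i * x i| ^ p ∂ bgPi θ N) =
      gammaMom p * ∑ S : Finset (Fin N),
        θ ^ S.card * (1 - θ) ^ (N - S.card) * Real.sqrt (∑ i ∈ S, d i ^ 2) ^ p := by
    have h := integral_map (μ := bgPi θ N) (φ := fun x => ∑ i, d i * x i)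
      (f := fun y : ℝ => |y| ^ p) (Measurable.aemeasurable (by fun_prop)) (by fun_prop)
    rw [← h, map_eq hθ, int_mixG hθ N d _ (fun v => absMom_integrable v p), Finset.mul_sum]
    refine Finset.sum_congr rfl fun S _ => ?_
    rw [absMom, Real.coe_toNNReal _ (Finset.sum_nonneg fun i _ => sq_nonneg _), smul_eq_mul]
    ring
  refine ⟨key, ?_⟩
  rw [key]
  have hg : 0 ≤ gammaMom p := by
    rw [← absMom_std]
    exact integral_nonneg fun x => by positivity
  refine mul_le_mul_of_nonneg_left ?_ hg
  have hθ0 := hθ.1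
  have h1 : 0 < 1 - θ := by linarith [hθ.2]
  calc _ ≤ ∑ S : Finset (Fin N), θ ^ S.card * (1 - θ) ^ (N - S.card) * ∑ i ∈ S, d i ^ 2 := by
        refine Finset.sum_le_sum fun S _ => mul_le_mul_of_nonneg_left ?_ (by positivity)
        have hs : 0 ≤ ∑ i ∈ S, d i ^ 2 := Finset.sum_nonneg fun i _ => sq_nonneg _
        have hs1 : ∑ i ∈ S, d i ^ 2 ≤ 1 := by
          rw [← hd]
          exact Finset.sum_le_sum_of_subset_of_nonneg (Finset.subset_univ _)
            fun i _ _ => sq_nonneg _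
        calc _ ≤ √(∑ i ∈ S, d i ^ 2) ^ 2 :=
              pow_le_pow_of_le_one (Real.sqrt_nonneg _) (Real.sqrt_le_one.mpr hs1) hp
          _ = _ := Real.sq_sqrt hs
    _ = ∑ i, d i ^ 2 * ∑ S : Finset (Fin N),
          (θ ^ S.card * (1 - θ) ^ (N - S.card) * if i ∈ S then 1 else 0) := by
        simp_rw [Finset.mul_sum]
        rw [Finset.sum_comm]
        refine Finset.sum_congr rfl fun S _ => ?_
        simp only [mul_ite, mul_one, mul_zero, Finset.sum_ite_mem, Finset.univ_inter]
        exact Finset.sum_congr rfl fun i _ => mul_comm _ _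
    _ = θ := by simp_rw [weight_mem]; rw [← Finset.sum_mul, hd, one_mul]
end

section
/- Let x ∈ ℝ^N be a Bernoulli–Gaussian random vector with parameter θ ∈ (0,1). Then for any two unit vectors d₁, d₂ ∈ S^{N−1}, |𝔼[|d₁ᵀx|³] − 𝔼[|d₂ᵀx|³]| ≤ 4 γ₃ ‖d₁ − d₂‖, i.e., the population objective d ↦ 𝔼[|dᵀx|³] is 4γ₃-Lipschitz on the unit sphere. -/
open MeasureTheory ProbabilityTheory Real

/-- γ₃ = 2√(2/π), the third absolute moment of a standard Gaussian. -/
noncomputable def gammaThree : ℝ := 2 * Real.sqrt (2 / π)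


structure GoodRV {Ω : Type*} [MeasurableSpace Ω] (μ : Measure Ω) (Y : Ω → ℝ) (v : ℝ) : Prop where
  meas : Measurable Y
  i1 : Integrable (fun ω => Y ω) μ
  i2 : Integrable (fun ω => Y ω ^ 2) μ
  i3 : Integrable (fun ω => Y ω ^ 3) μ
  i4 : Integrable (fun ω => Y ω ^ 4) μ
  e1 : ∫ ω, Y ω ∂μ = 0
  e2 : ∫ ω, Y ω ^ 2 ∂μ ≤ v
  e4 : ∫ ω, Y ω ^ 4 ∂μ ≤ 3 * v ^ 2

lemma GoodRV.add {Ω : Type*} [MeasurableSpace Ω] {μ : Measure Ω} {Y Z : Ω → ℝ} {v w : ℝ}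
    (hY : GoodRV μ Y v) (hZ : GoodRV μ Z w) (h : IndepFun Y Z μ) :
    GoodRV μ (fun ω => Y ω + Z ω) (v + w) := by
  have hc : ∀ i j : ℕ, IndepFun (fun ω => Y ω ^ i) (fun ω => Z ω ^ j) μ := fun i j =>
    h.comp (φ := fun x => x ^ i) (ψ := fun x => x ^ j) (by fun_prop) (by fun_prop)
  have h11 := h.integrable_mul hY.i1 hZ.i1
  have hc12 : IndepFun Y (fun ω => Z ω ^ 2) μ := by simpa using hc 1 2
  have hc21 : IndepFun (fun ω => Y ω ^ 2) Z μ := by simpa using hc 2 1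
  have hc13 : IndepFun Y (fun ω => Z ω ^ 3) μ := by simpa using hc 1 3
  have hc31 : IndepFun (fun ω => Y ω ^ 3) Z μ := by simpa using hc 3 1
  have h12 := hc12.integrable_mul hY.i1 hZ.i2
  have h21 := hc21.integrable_mul hY.i2 hZ.i1
  have h13 := hc13.integrable_mul hY.i1 hZ.i3
  have h31 := hc31.integrable_mul hY.i3 hZ.i1
  have h22 := (hc 2 2).integrable_mul hY.i2 hZ.i2
  have mY := hY.meas
  have mZ := hZ.meas
  have E11 := h.integral_mul_eq_mul_integral (by fun_prop) (by fun_prop)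
  have E13 := hc13.integral_mul_eq_mul_integral (by fun_prop) (by fun_prop)
  have E31 := hc31.integral_mul_eq_mul_integral (by fun_prop) (by fun_prop)
  have E22 := (hc 2 2).integral_mul_eq_mul_integral (by fun_prop) (by fun_prop)
  have x2 : (fun ω => (Y ω + Z ω) ^ 2) =
      (fun ω => Y ω ^ 2 + 2 * (Y * Z) ω + Z ω ^ 2) := by
    funext ω; simp only [Pi.mul_apply]; ring
  have x3 : (fun ω => (Y ω + Z ω) ^ 3) =
      (fun ω => Y ω ^ 3 + 3 * ((fun ω => Y ω ^ 2) * Z) ω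
        + 3 * (Y * (fun ω => Z ω ^ 2)) ω + Z ω ^ 3) := by
    funext ω; simp only [Pi.mul_apply]; ring
  have x4 : (fun ω => (Y ω + Z ω) ^ 4) =
      (fun ω => Y ω ^ 4 + 4 * ((fun ω => Y ω ^ 3) * Z) ω
        + 6 * ((fun ω => Y ω ^ 2) * (fun ω => Z ω ^ 2)) ω
        + 4 * (Y * (fun ω => Z ω ^ 3)) ω + Z ω ^ 4) := by
    funext ω; simp only [Pi.mul_apply]; ring
  have a2 := hY.i2.fun_add (h11.const_mul 2)
  have a3 := hY.i4.fun_add (h31.const_mul 4)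
  have a4 := a3.fun_add (h22.const_mul 6)
  have a5 := a4.fun_add (h13.const_mul 4)
  refine ⟨by fun_prop, hY.i1.add hZ.i1, ?_, ?_, ?_, ?_, ?_, ?_⟩
  · rw [x2]; exact a2.add hZ.i2
  · rw [x3]; exact ((hY.i3.add (h21.const_mul 3)).add (h12.const_mul 3)).add hZ.i3
  · rw [x4]; exact a5.add hZ.i4
  · rw [integral_add hY.i1 hZ.i1, hY.e1, hZ.e1, add_zero]
  · rw [x2, integral_add a2 hZ.i2, integral_add hY.i2 (h11.const_mul 2), integral_const_mul, E11,
      hY.e1]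
    linarith [hY.e2, hZ.e2]
  · rw [x4, integral_add a5 hZ.i4, integral_add a4 (h13.const_mul 4),
      integral_add a3 (h22.const_mul 6), integral_add hY.i4 (h31.const_mul 4),
      integral_const_mul, integral_const_mul, integral_const_mul, E13, E31, E22, hY.e1, hZ.e1]
    have p1 : 0 ≤ ∫ ω, Y ω ^ 2 ∂μ := integral_nonneg fun ω => by positivity
    have p2 : 0 ≤ ∫ ω, Z ω ^ 2 ∂μ := integral_nonneg fun ω => by positivity
    have := mul_le_mul hY.e2 hZ.e2 p2 (p1.trans hY.e2)
    nlinarith [hY.e4, hZ.e4]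

lemma gauss_moment_four : ∫ x, x ^ 4 ∂(gaussianReal 0 1) = 3 := by
  have h := iteratedDeriv_mgf_zero (X := fun x : ℝ => x) (μ := gaussianReal 0 1) (by simp) 4
  have e : ∫ x, x ^ 4 ∂(gaussianReal 0 1) = iteratedDeriv 4 (mgf (fun x => x) (gaussianReal 0 1)) 0 := by
    rw [h]; simp
  rw [e, mgf_fun_id_gaussianReal]
  have key : ∀ (p p' : ℝ → ℝ), (∀ t, HasDerivAt p (p' t) t) →
      deriv (fun t => p t * rexp (t ^ 2 / 2)) = fun t => (p' t + t * p t) * rexp (t ^ 2 / 2) := by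
    intro p p' hp
    funext t
    have h1 : HasDerivAt (fun t : ℝ => t ^ 2 / 2) t t := by
      have := (hasDerivAt_pow 2 t).div_const 2
      convert! this using 1; simp
    have := (hp t).mul h1.exp
    refine (HasDerivAt.deriv this).trans ?_
    ring
  have hf : (fun t : ℝ => rexp (0 * t + ((1 : NNReal) : ℝ) * t ^ 2 / 2)) =
      fun t => (1 : ℝ) * rexp (t ^ 2 / 2) := by
    funext t; simp
  rw [hf, iteratedDeriv_succ, iteratedDeriv_succ, iteratedDeriv_succ, iteratedDeriv_one]
  rw [key (fun _ => 1) (fun _ => 0) (fun t => hasDerivAt_const t 1)]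
  rw [key (fun t => 0 + t * 1) (fun _ => 1) (fun t => by convert! hasDerivAt_id t using 1; funext t; simp)]
  rw [key (fun t => 1 + t * (0 + t * 1)) (fun t => 2 * t) (fun t => by
    have := (hasDerivAt_pow 2 t).const_add 1
    convert! this using 1
    · funext t; ring
    · simp)]
  rw [key (fun t => 2 * t + t * (1 + t * (0 + t * 1))) (fun t => 3 + 3 * t ^ 2) (fun t => by
    have := ((hasDerivAt_id t).const_mul 3).add (hasDerivAt_pow 3 t)
    convert! this using 1
    · funext t; simp; ring
    · simp)]
  simp

lemma gauss_moment_two : ∫ x, x ^ 2 ∂(gaussianReal 0 1) = 1 := by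
  have h := variance_fun_id_gaussianReal (μ := 0) (v := 1)
  rw [variance_eq_integral measurable_id'.aemeasurable] at h
  simpa using h

lemma gauss_int (k : ℕ) : Integrable (fun x : ℝ => x ^ k) (gaussianReal 0 1) := by
  have h := (memLp_id_gaussianReal (μ := 0) (v := 1) (k : NNReal)).integrable_norm_pow'
  simp only [id] at h
  refine h.mono' (by fun_prop) (ae_of_all _ fun x => ?_)
  simp

lemma bg_int (θ : ℝ) (k : ℕ) : Integrable (fun x : ℝ => x ^ k) (bgMeasure θ) := by
  unfold bgMeasure
  refine Integrable.add_measure ?_ ?_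
  · exact (integrable_dirac (by simp)).smul_measure_nnreal
  · exact (gauss_int k).smul_measure_nnreal

lemma bg_moment (θ : ℝ) (hθ : θ ∈ Set.Ioo (0 : ℝ) 1) (k : ℕ) (hk : k ≠ 0) :
    ∫ x, x ^ k ∂(bgMeasure θ) = θ * ∫ x, x ^ k ∂(gaussianReal 0 1) := by
  unfold bgMeasure
  rw [integral_add_measure, integral_smul_nnreal_measure, integral_smul_nnreal_measure]
  · simp [hk, NNReal.smul_def, hθ.1.le]
  · exact (integrable_dirac (by simp)).smul_measure_nnreal
  · exact (gauss_int k).smul_measure_nnreal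

lemma bg_prob (θ : ℝ) (hθ : θ ∈ Set.Ioo (0 : ℝ) 1) : IsProbabilityMeasure (bgMeasure θ) := by
  constructor
  unfold bgMeasure
  simp only [Measure.add_apply, Measure.smul_apply, measure_univ]
  have h1 : 0 ≤ 1 - θ := by linarith [hθ.2]
  simp only [ENNReal.smul_def, smul_eq_mul, mul_one]
  rw [← ENNReal.coe_add, ← Real.toNNReal_add h1 hθ.1.le]
  simp

lemma bg_good (θ : ℝ) (hθ : θ ∈ Set.Ioo (0 : ℝ) 1) (c : ℝ) :
    GoodRV (bgMeasure θ) (fun x => c * x) (c ^ 2) := by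
  have i1 : Integrable (fun x : ℝ => x) (bgMeasure θ) := by simpa using bg_int θ 1
  have m1 : ∫ x, x ∂(bgMeasure θ) = 0 := by simpa using bg_moment θ hθ 1 one_ne_zero
  refine ⟨by fun_prop, i1.const_mul c, ?_, ?_, ?_, ?_, ?_, ?_⟩
  · simp only [mul_pow]; exact (bg_int θ 2).const_mul _
  · simp only [mul_pow]; exact (bg_int θ 3).const_mul _
  · simp only [mul_pow]; exact (bg_int θ 4).const_mul _
  · rw [integral_const_mul, m1, mul_zero]
  · simp only [mul_pow]
    rw [integral_const_mul, bg_moment θ hθ 2 two_ne_zero, gauss_moment_two]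
    nlinarith [sq_nonneg c, hθ.2]
  · simp only [mul_pow]
    rw [integral_const_mul, bg_moment θ hθ 4 four_ne_zero, gauss_moment_four]
    have : 0 ≤ c ^ 4 := by positivity
    nlinarith [hθ.2]

lemma bg_coord_good (N : ℕ) (θ : ℝ) (hθ : θ ∈ Set.Ioo (0 : ℝ) 1) (c : ℝ) (i : Fin N) :
    GoodRV (bgPi θ N) (fun x => c * x i) (c ^ 2) := by
  have := bg_prob θ hθ
  have mp : MeasurePreserving (Function.eval i) (bgPi θ N) (bgMeasure θ) :=
    measurePreserving_eval (fun _ : Fin N => bgMeasure θ) i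
  have g := bg_good θ hθ c
  have int : ∀ f : ℝ → ℝ, Measurable f →
      ∫ x, f (x i) ∂(bgPi θ N) = ∫ y, f y ∂(bgMeasure θ) := fun f hf => by
    rw [← mp.map_eq, integral_map mp.measurable.aemeasurable hf.aestronglyMeasurable]
  refine ⟨by fun_prop, mp.integrable_comp_of_integrable g.i1, mp.integrable_comp_of_integrable g.i2,
    mp.integrable_comp_of_integrable g.i3, mp.integrable_comp_of_integrable g.i4, ?_, ?_, ?_⟩
  · rw [int (fun y => c * y) (by fun_prop)]; exact g.e1
  · rw [int (fun y => (c * y) ^ 2) (by fun_prop)]; exact g.e2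
  · rw [int (fun y => (c * y) ^ 4) (by fun_prop)]; exact g.e4

lemma bg_sum_good (N : ℕ) (θ : ℝ) (hθ : θ ∈ Set.Ioo (0 : ℝ) 1) (c : Fin N → ℝ) :
    GoodRV (bgPi θ N) (fun x => ∑ i, c i * x i) (∑ i, c i ^ 2) := by
  have := bg_prob θ hθ
  have hind : iIndepFun (fun (i : Fin N) (x : Fin N → ℝ) => c i * x i) (bgPi θ N) :=
    iIndepFun_pi (μ := fun _ : Fin N => bgMeasure θ) (X := fun i y => c i * y)
      (fun i => by fun_prop)
  suffices H : ∀ s : Finset (Fin N),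
      GoodRV (bgPi θ N) (fun x => ∑ i ∈ s, c i * x i) (∑ i ∈ s, c i ^ 2) from H Finset.univ
  intro s
  induction s using Finset.induction_on with
  | empty => constructor <;> simp
  | insert a s ha ih =>
    have h := hind.indepFun_finsetSum_of_notMem (fun i => by fun_prop) ha
    have e : (∑ j ∈ s, fun x : Fin N → ℝ => c j * x j) = fun x => ∑ j ∈ s, c j * x j := by
      funext x; simp
    rw [e] at h
    have r := ih.add (bg_coord_good N θ hθ (c a) a) h
    simp only [Finset.sum_insert ha]
    simpa only [add_comm] using r

lemma cube_diff (a b t : ℝ) (ht : 0 < t) :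
    |(|a| ^ 3 - |b| ^ 3)| ≤ (3 / 2) * (t * (a - b) ^ 2 + (a ^ 4 + b ^ 4) / (2 * t)) := by
  have h1 : |(|a| ^ 3 - |b| ^ 3)| ≤ |a - b| * ((3 / 2) * (a ^ 2 + b ^ 2)) := by
    have e : |a| ^ 3 - |b| ^ 3 = (|a| - |b|) * (|a| ^ 2 + |a| * |b| + |b| ^ 2) := by ring
    rw [e, abs_mul]
    have : 0 ≤ |a| ^ 2 + |a| * |b| + |b| ^ 2 := by positivity
    rw [abs_of_nonneg this]
    refine mul_le_mul (abs_abs_sub_abs_le a b) ?_ this (abs_nonneg _)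
    nlinarith [sq_abs a, sq_abs b, sq_nonneg (|a| - |b|)]
  refine h1.trans ?_
  have h2 : ∀ c : ℝ, |a - b| * c ^ 2 ≤ (t * (a - b) ^ 2 + c ^ 4 / t) / 2 := by
    intro c
    have e : (t * (a - b) ^ 2 + c ^ 4 / t) / 2 - |a - b| * c ^ 2
        = (t * |a - b| - c ^ 2) ^ 2 / (2 * t) := by
      rw [← sq_abs (a - b)]; field_simp; ring
    have : 0 ≤ (t * |a - b| - c ^ 2) ^ 2 / (2 * t) := by positivity
    linarith
  have e : (a ^ 4 + b ^ 4) / (2 * t) = a ^ 4 / t / 2 + b ^ 4 / t / 2 := by field_simp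
  rw [e]
  linarith [h2 a, h2 b]

lemma abs_cube_int {Ω : Type*} [MeasurableSpace Ω] {μ : Measure Ω} {Y : Ω → ℝ} {v : ℝ}
    (h : GoodRV μ Y v) : Integrable (fun ω => |Y ω| ^ 3) μ := by
  have := h.i3.abs
  simpa only [abs_pow] using this

/-- For x ~ BG(θ), the population objective d ↦ 𝔼[|dᵀx|³] is
4γ₃-Lipschitz on the unit sphere. -/
theorem stmt3 (N : ℕ) (θ : ℝ) (hθ : θ ∈ Set.Ioo (0 : ℝ) 1)
    (d₁ d₂ : Fin N → ℝ) (hd₁ : ∑ i, d₁ i ^ 2 = 1) (hd₂ : ∑ i, d₂ i ^ 2 = 1) :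
    |(∫ x, |∑ i, d₁ i * x i| ^ 3 ∂ bgPi θ N) - ∫ x, |∑ i, d₂ i * x i| ^ 3 ∂ bgPi θ N| ≤
      4 * gammaThree * Real.sqrt (∑ i, (d₁ i - d₂ i) ^ 2) := by
  have g1 := bg_sum_good N θ hθ d₁
  have g2 := bg_sum_good N θ hθ d₂
  have g := bg_sum_good N θ hθ (fun i => d₁ i - d₂ i)
  rw [hd₁] at g1
  rw [hd₂] at g2
  have hs : 0 ≤ ∑ i, (d₁ i - d₂ i) ^ 2 := Finset.sum_nonneg fun i _ => sq_nonneg _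
  set δ := Real.sqrt (∑ i, (d₁ i - d₂ i) ^ 2) with hδ
  have hδ2 : ∑ i, (d₁ i - d₂ i) ^ 2 = δ ^ 2 := (Real.sq_sqrt hs).symm
  have hδ0 : 0 ≤ δ := Real.sqrt_nonneg _
  rcases hδ0.eq_or_lt with h0 | hpos
  · have hz : ∑ i, (d₁ i - d₂ i) ^ 2 = 0 := by rw [hδ2, ← h0]; simp
    rw [Finset.sum_eq_zero_iff_of_nonneg (fun i _ => sq_nonneg _)] at hz
    have : d₁ = d₂ := by
      funext i
      have := hz i (Finset.mem_univ i)
      nlinarith [pow_eq_zero_iff (two_ne_zero) |>.1 this]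
    subst this
    simp [← h0]
  · rw [hδ2] at g
    have ht : 0 < 2 / δ := by positivity
    have eu : ∀ x : Fin N → ℝ, ∑ i, (d₁ i - d₂ i) * x i = ∑ i, d₁ i * x i - ∑ i, d₂ i * x i := by
      intro x; rw [← Finset.sum_sub_distrib]; simp only [sub_mul]
    have gi2 := g.i2
    have ge2 := g.e2
    simp only [eu] at gi2 ge2
    rw [← integral_sub (abs_cube_int g1) (abs_cube_int g2)]
    have hI := (g1.i4.fun_add g2.i4).div_const (2 * (2 / δ))
    have hJ := gi2.const_mul (2 / δ)
    have hle : ∫ x, |(|∑ i, d₁ i * x i| ^ 3 - |∑ i, d₂ i * x i| ^ 3)| ∂ bgPi θ N ≤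
        ∫ x, (3 / 2) * (2 / δ * (∑ i, d₁ i * x i - ∑ i, d₂ i * x i) ^ 2 +
          ((∑ i, d₁ i * x i) ^ 4 + (∑ i, d₂ i * x i) ^ 4) / (2 * (2 / δ))) ∂ bgPi θ N :=
      integral_mono ((abs_cube_int g1).sub (abs_cube_int g2)).abs ((hJ.add hI).const_mul _)
        (fun x => cube_diff _ _ _ ht)
    refine (abs_integral_le_integral_abs.trans hle).trans ?_
    rw [integral_const_mul, integral_add hJ hI, integral_const_mul, integral_div,
      integral_add g1.i4 g2.i4]
    have b1 := mul_le_mul_of_nonneg_left ge2 ht.le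
    have e1 : 2 / δ * δ ^ 2 = 2 * δ := by field_simp
    have b2 := div_le_div_of_nonneg_right (add_le_add g1.e4 g2.e4)
      (show 0 ≤ 2 * (2 / δ) by positivity)
    have e2 : (3 * (1 : ℝ) ^ 2 + 3 * 1 ^ 2) / (2 * (2 / δ)) = 3 / 2 * δ := by field_simp; norm_num
    rw [e1] at b1
    rw [e2] at b2
    have hγ : 4 / 3 ≤ gammaThree := by
      unfold gammaThree
      have : 2 / 3 ≤ Real.sqrt (2 / π) := by
        apply Real.le_sqrt_of_sq_le
        rw [le_div_iff₀ Real.pi_pos]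
        nlinarith [Real.pi_le_four]
      linarith
    nlinarith
end

section
/- Let x ∈ ℝ^N be a Bernoulli–Gaussian random vector with parameter θ ∈ (1/N, 1/2). For a unit vector d ∈ S^{N−1}, the Riemannian gradient of the population objective vanishes, i.e., (I − d dᵀ) 𝔼[(dᵀx)|dᵀx| x] = 0, if and only if d belongs to the set S' = { (1/√k) v : v ∈ {−1, 0, 1}^N, ‖v‖₀ = k, k ∈ {1, …, N} }, where ‖v‖₀ is the number of nonzero entries of v. In particular the stationary points of the population problem are isolated, and k = 1 corresponds to the 2N points {±e₁, …, ±e_N}. -/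
open MeasureTheory ProbabilityTheory Real

/-- 𝔼[(dᵀx)|dᵀx| x_j] for x ~ BG(θ)^N; up to the factor −3 this is the j-th coordinate
of the gradient ∇F(d) = −3𝔼[(dᵀx)|dᵀx|x] of the population objective F(d) = −𝔼[|dᵀx|³]. -/
noncomputable def popG (θ : ℝ) (N : ℕ) (d : Fin N → ℝ) (j : Fin N) : ℝ :=
  ∫ x, (∑ i, d i * x i) * |∑ i, d i * x i| * x j ∂ bgPi θ N

open scoped Classical in
/-- The set S' = { (1/√k) v : v ∈ {−1,0,1}^N, ‖v‖₀ = k, k ∈ {1,…,N} }. -/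
noncomputable def Sprime (N : ℕ) : Set (Fin N → ℝ) :=
  {d | ∃ k ∈ Finset.Icc 1 N, ∃ v : Fin N → ℝ,
    (∀ i, v i = -1 ∨ v i = 0 ∨ v i = 1) ∧
    (Finset.univ.filter fun i => v i ≠ 0).card = k ∧
    ∀ i, d i = v i / Real.sqrt k}

instance bgProb' (θ : ℝ) [h : Fact (0 < θ ∧ θ < 1)] : IsProbabilityMeasure (bgMeasure θ) := by
  constructor
  have h0 := h.out.1
  have h1 := h.out.2
  simp only [bgMeasure, Measure.add_apply, Measure.smul_apply, measure_univ]
  rw [ENNReal.smul_def, ENNReal.smul_def]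
  simp only [smul_eq_mul, mul_one]
  change ENNReal.ofReal (1 - θ) + ENNReal.ofReal θ = 1
  rw [← ENNReal.ofReal_add (by linarith) h0.le]
  simp

lemma memLp_bg (θ : ℝ) : MemLp (fun x : ℝ => x) 3 (bgMeasure θ) := by
  have hg : MemLp (fun x : ℝ => x) 3 (gaussianReal 0 1) :=
    memLp_id_gaussianReal' 3 (by simp)
  have hd : MemLp (fun x : ℝ => x) 3 (Measure.dirac (0:ℝ)) := by
    refine ⟨by fun_prop, ?_⟩
    have : eLpNorm (fun x : ℝ => x) 3 (Measure.dirac (0:ℝ)) = eLpNorm (0 : ℝ → ℝ) 3 (Measure.dirac (0:ℝ)) := by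
      apply eLpNorm_congr_ae
      rw [Filter.EventuallyEq, ae_dirac_eq]
      simp
    rw [this]; simp
  unfold bgMeasure
  have h1 := hd.smul_measure (c := ((1 - θ).toNNReal : ENNReal)) (by simp)
  have h2 := hg.smul_measure (c := (θ.toNNReal : ENNReal)) (by simp)
  have hm : AEStronglyMeasurable (fun x : ℝ => x)
      ((1 - θ).toNNReal • Measure.dirac (0:ℝ) + θ.toNNReal • gaussianReal 0 1) := by fun_prop
  rw [← integrable_norm_rpow_iff hm (by simp) (by simp)]
  exact (h1.integrable_norm_rpow (by simp) (by simp)).add_measure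
    (h2.integrable_norm_rpow (by simp) (by simp))

lemma integrable_cub {α : Type*} [MeasurableSpace α] {μ : Measure α} {u v : α → ℝ}
    (hu : MemLp u 3 μ) (hv : MemLp v 3 μ) : Integrable (fun x => u x * |u x| * v x) μ := by
  have h1 : Integrable (fun x => ‖u x‖ ^ 3) μ := hu.integrable_norm_pow (p := 3) (by simp)
  have h2 : Integrable (fun x => ‖v x‖ ^ 3) μ := hv.integrable_norm_pow (p := 3) (by simp)
  have hum := hu.1
  have hvm := hv.1
  refine (h1.add h2).mono' ?_ ?_
  · exact (hum.mul hum.norm).mul hvm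
  · filter_upwards with x
    simp only [norm_mul, Real.norm_eq_abs, abs_abs, Pi.add_apply]
    have ha := abs_nonneg (u x)
    have hb := abs_nonneg (v x)
    rcases le_total |u x| |v x| with h | h
    · have := mul_le_mul (mul_le_mul h h ha hb) le_rfl hb (by positivity)
      nlinarith [pow_nonneg ha 3]
    · have := mul_le_mul_of_nonneg_left h (mul_nonneg ha ha)
      nlinarith [pow_nonneg hb 3]

lemma integral_bg {θ : ℝ} (h0 : 0 < θ) (h1 : θ < 1) {f : ℝ → ℝ}
    (hf : Integrable f (bgMeasure θ)) :
    Integrable f (gaussianReal 0 1) ∧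
    ∫ x, f x ∂(bgMeasure θ) = (1 - θ) * f 0 + θ * ∫ x, f x ∂(gaussianReal 0 1) := by
  unfold bgMeasure at hf ⊢
  have ha := hf.left_of_add_measure
  have hb := hf.right_of_add_measure
  rw [integral_add_measure ha hb, integral_smul_nnreal_measure, integral_smul_nnreal_measure,
    integral_dirac]
  constructor
  · have : θ.toNNReal ≠ 0 := by simpa using h0
    exact (integrable_smul_measure (c := (θ.toNNReal : ENNReal)) (by simpa using h0) (by simp)).1 hb
  · simp [NNReal.smul_def, h0.le, h1.le]

lemma both_zero (r a b : ℝ) :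
    ∫ p : ℝ × ℝ, (r + a * p.1 + b * p.2) * |r + a * p.1 + b * p.2| * (b * p.1 - a * p.2)
      ∂((gaussianReal 0 1).prod (gaussianReal 0 1)) = 0 := by
  set z : ℂ := ⟨a, b⟩
  set ρ := ‖z‖
  set φ := z.arg
  have ha : a = ρ * Real.cos φ := (Complex.norm_mul_cos_arg z).symm
  have hb : b = ρ * Real.sin φ := (Complex.norm_mul_sin_arg z).symm
  have hrot := IsGaussian.map_rotation_eq_self (μ := gaussianReal 0 1) (by simp) φ
  set G : ℝ × ℝ → ℝ := fun q => ((r + ρ * q.1) * |r + ρ * q.1| * (-ρ)) * q.2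
  have hG : ∀ p : ℝ × ℝ, (r + a * p.1 + b * p.2) * |r + a * p.1 + b * p.2| * (b * p.1 - a * p.2)
      = G (ContinuousLinearMap.rotation φ p) := by
    intro p
    simp only [G, ContinuousLinearMap.rotation_apply, smul_eq_mul]
    rw [show r + a * p.1 + b * p.2 = r + ρ * (Real.cos φ * p.1 + Real.sin φ * p.2) by
      rw [ha, hb]; ring]
    rw [show b * p.1 - a * p.2 = -ρ * (-Real.sin φ * p.1 + Real.cos φ * p.2) by
      rw [ha, hb]; ring]
    ring
  simp_rw [hG]
  have hGm : Measurable G := by fun_prop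
  rw [← integral_map (φ := ContinuousLinearMap.rotation φ) (f := G) (by fun_prop)
    (by exact hGm.aestronglyMeasurable), hrot]
  simp only [G]
  rw [integral_prod_mul (fun x : ℝ => (r + ρ * x) * |r + ρ * x| * (-ρ)) (fun y : ℝ => y)]
  simp

noncomputable def PP (r a : ℝ) : ℝ := ∫ y, (r + a * y) * |r + a * y| * y ∂(gaussianReal 0 1)

lemma memLp_gauss : MemLp (fun x : ℝ => x) 3 (gaussianReal 0 1) :=
    memLp_id_gaussianReal' 3 (by simp)

lemma PP_int (r a : ℝ) : Integrable (fun y => (r + a * y) * |r + a * y| * y) (gaussianReal 0 1) :=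
  integrable_cub ((memLp_const r).add (memLp_gauss.const_mul a)) memLp_gauss

lemma two_int {θ : ℝ} (h0 : 0 < θ) (h1 : θ < 1) (r a b : ℝ) :
    ∫ p : ℝ × ℝ, (r + a * p.1 + b * p.2) * |r + a * p.1 + b * p.2| * (b * p.1 - a * p.2)
      ∂((bgMeasure θ).prod (bgMeasure θ)) = θ * (1 - θ) * (b * PP r a - a * PP r b) := by
  have : Fact (0 < θ ∧ θ < 1) := ⟨h0, h1⟩
  set H : ℝ × ℝ → ℝ := fun p =>
    (r + a * p.1 + b * p.2) * |r + a * p.1 + b * p.2| * (b * p.1 - a * p.2) with hH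
  have gen : ∀ μ ν : Measure ℝ, IsProbabilityMeasure μ → IsProbabilityMeasure ν →
      MemLp (fun x : ℝ => x) 3 μ → MemLp (fun x : ℝ => x) 3 ν → Integrable H (μ.prod ν) := by
    intro μ ν _ _ hμ hν
    have e1 : MemLp (fun p : ℝ × ℝ => p.1) 3 (μ.prod ν) :=
      hμ.comp_measurePreserving measurePreserving_fst
    have e2 : MemLp (fun p : ℝ × ℝ => p.2) 3 (μ.prod ν) :=
      hν.comp_measurePreserving measurePreserving_snd
    exact integrable_cub (((memLp_const r).add (e1.const_mul a)).add (e2.const_mul b))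
      ((e1.const_mul b).sub (e2.const_mul a))
  have i1 := gen (bgMeasure θ) (bgMeasure θ) inferInstance inferInstance (memLp_bg θ) (memLp_bg θ)
  have i2 := gen (bgMeasure θ) (gaussianReal 0 1) inferInstance inferInstance (memLp_bg θ) memLp_gauss
  have i3 := gen (gaussianReal 0 1) (gaussianReal 0 1) inferInstance inferInstance memLp_gauss memLp_gauss
  have inner : ∀ x, ∫ y, H (x, y) ∂(bgMeasure θ)
      = (1 - θ) * H (x, 0) + θ * ∫ y, H (x, y) ∂(gaussianReal 0 1) := by
    intro x
    refine (integral_bg h0 h1 ?_).2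
    exact integrable_cub (((memLp_const r).add (memLp_const (a * x))).add ((memLp_bg θ).const_mul b))
      ((memLp_const (b * x)).sub ((memLp_bg θ).const_mul a))
  have k1 : Integrable (fun x => H (x, 0)) (bgMeasure θ) := by
    have := integrable_cub (((memLp_const r).add ((memLp_bg θ).const_mul a))) ((memLp_bg θ).const_mul b)
    refine this.congr (Filter.Eventually.of_forall fun x => ?_)
    simp [hH]
  have k2 : Integrable (fun x => ∫ y, H (x, y) ∂(gaussianReal 0 1)) (bgMeasure θ) :=
    i2.integral_prod_left
  rw [integral_prod _ i1]
  simp_rw [inner]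
  rw [integral_add (k1.const_mul _) (k2.const_mul _), integral_const_mul, integral_const_mul,
    (integral_bg h0 h1 k1).2, (integral_bg h0 h1 k2).2, ← integral_prod _ i3, both_zero]
  have z1 : H (0, 0) = 0 := by simp [hH]
  have z2 : ∫ x, H (x, 0) ∂(gaussianReal 0 1) = b * PP r a := by
    unfold PP
    rw [← integral_const_mul]
    congr 1; ext x; simp [hH]; ring
  have z3 : ∫ y, H (0, y) ∂(gaussianReal 0 1) = - (a * PP r b) := by
    unfold PP
    rw [← integral_const_mul, ← integral_neg]
    congr 1; ext x; simp [hH]; ring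
  rw [z1, z2, z3]; ring

noncomputable def tg (r t : ℝ) : ℝ := t * ((r + t) * |r + t| - (r - t) * |r - t|)

lemma tg_eq (r t : ℝ) : tg r t = if |t| ≤ |r| then 4 * |r| * t ^ 2 else 2 * |t| * (t ^ 2 + r ^ 2) := by
  unfold tg
  split_ifs with h
  · rcases abs_cases r with ⟨hr, _⟩ | ⟨hr, _⟩ <;> rw [hr] at h ⊢ <;>
    have := abs_le.1 h
    · rw [abs_of_nonneg (by linarith), abs_of_nonneg (by linarith)]; ring
    · rw [abs_of_nonpos (by linarith), abs_of_nonpos (by linarith)]; ring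
  · push Not at h
    rcases abs_cases t with ⟨hr, _⟩ | ⟨hr, _⟩ <;> rw [hr] at h ⊢ <;>
    have := abs_lt.1 h
    · rw [abs_of_nonneg (by linarith), abs_of_nonpos (by linarith)]; ring
    · rw [abs_of_nonpos (by linarith), abs_of_nonneg (by linarith)]; ring

lemma tg_abs (r t : ℝ) : tg r |t| = tg r t := by
  rw [tg_eq, tg_eq]; simp

/-- pointwise monotonicity -/
lemma tg_mono (r s t : ℝ) (hs : |s| ≤ |t|) :
    t ^ 2 * tg r s ≤ s ^ 2 * tg r t := by
  rw [← tg_abs r s, ← tg_abs r t, ← sq_abs s, ← sq_abs t, tg_eq, tg_eq]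
  have h1 := abs_nonneg s
  have h2 := abs_nonneg t
  have h3 := abs_nonneg r
  rw [← sq_abs r, abs_abs, abs_abs]
  generalize |s| = S at *
  generalize |t| = T at *
  generalize |r| = R at *
  split_ifs with ha hb hb
  · nlinarith
  · push Not at hb
    have : 0 ≤ S ^ 2 * T * (T - R) ^ 2 := by positivity
    have h5 : 0 ≤ S ^ 2 * T ^ 2 := by positivity
    have : 2 * R * T ≤ T ^ 2 + R ^ 2 := by nlinarith [sq_nonneg (T - R)]
    have := mul_le_mul_of_nonneg_left this (show 0 ≤ 2 * S ^ 2 * T by positivity)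
    nlinarith
  · linarith
  · push Not at ha hb
    -- S T [ S(T²+R²) - T(S²+R²) ] = S T (T-S)(ST - R²)
    have e : S ^ 2 * (2 * T * (T ^ 2 + R ^ 2)) - T ^ 2 * (2 * S * (S ^ 2 + R ^ 2))
      = 2 * (S * T) * ((T - S) * (S * T - R ^ 2)) := by ring
    have : R ^ 2 ≤ S * T := by nlinarith
    have : 0 ≤ 2 * (S * T) * ((T - S) * (S * T - R ^ 2)) :=
      mul_nonneg (by positivity) (mul_nonneg (by linarith) (by linarith))
    linarith

lemma tg_strict (r s t : ℝ) (hs : |s| < |t|) (hs0 : s ≠ 0) (hr : |r| < |t|) :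
    t ^ 2 * tg r s < s ^ 2 * tg r t := by
  rw [← tg_abs r s, ← tg_abs r t, ← sq_abs s, ← sq_abs t, tg_eq, tg_eq]
  have h1 := abs_pos.2 hs0
  have h2 := abs_nonneg t
  have h3 := abs_nonneg r
  rw [← sq_abs r, abs_abs, abs_abs]
  generalize |s| = S at *
  generalize |t| = T at *
  generalize |r| = R at *
  have hT : 0 < T := by linarith
  split_ifs with ha hb hb
  · linarith
  · have h6 : 0 < (T - R) ^ 2 := by have : 0 < T - R := by linarith
                                    positivity
    have : 2 * R * T < T ^ 2 + R ^ 2 := by nlinarith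
    have := mul_lt_mul_of_pos_left this (show 0 < 2 * S ^ 2 * T by positivity)
    nlinarith
  · linarith
  · push Not at ha hb
    have e : S ^ 2 * (2 * T * (T ^ 2 + R ^ 2)) - T ^ 2 * (2 * S * (S ^ 2 + R ^ 2))
      = 2 * (S * T) * ((T - S) * (S * T - R ^ 2)) := by ring
    have : R ^ 2 < S * T := by nlinarith
    have : 0 < 2 * (S * T) * ((T - S) * (S * T - R ^ 2)) :=
      mul_pos (by positivity) (mul_pos (by linarith) (by linarith))
    linarith

lemma gauss_symm (f : ℝ → ℝ) : ∫ y, f (-y) ∂(gaussianReal 0 1) = ∫ y, f y ∂(gaussianReal 0 1) := by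
  have h := gaussianReal_map_neg (μ := 0) (v := 1)
  rw [neg_zero] at h
  conv_rhs => rw [← h]
  exact ((MeasurableEquiv.neg ℝ).measurableEmbedding.integral_map f).symm

lemma tg_int (r a : ℝ) : Integrable (fun y => tg r (a * y)) (gaussianReal 0 1) := by
  have h1 := integrable_cub ((memLp_const r).add (memLp_gauss.const_mul a)) (memLp_gauss.const_mul a)
  have h2 := integrable_cub ((memLp_const r).sub (memLp_gauss.const_mul a)) (memLp_gauss.const_mul a)
  refine (h1.sub h2).congr (Filter.Eventually.of_forall fun x => ?_)
  simp [tg]; ring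

lemma PP_tg (r a : ℝ) : 2 * (a * PP r a) = ∫ y, tg r (a * y) ∂(gaussianReal 0 1) := by
  have h1 := gauss_symm (fun y => (r + a * y) * |r + a * y| * y)
  have i1 := (PP_int r a).const_mul a
  have i2 : Integrable (fun y => a * ((r + a * (-y)) * |r + a * (-y)| * (-y))) (gaussianReal 0 1) := by
    have := integrable_cub ((memLp_const r).add (memLp_gauss.const_mul (-a))) (memLp_gauss.const_mul (-a))
    refine this.congr (Filter.Eventually.of_forall fun x => ?_)
    simp; ring
  have : ∀ y, tg r (a * y) = a * ((r + a * y) * |r + a * y| * y)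
      + a * ((r + a * (-y)) * |r + a * (-y)| * (-y)) := by
    intro y; simp only [tg, mul_neg, ← sub_eq_add_neg]; ring
  simp_rw [this]
  rw [integral_add i1 i2, integral_const_mul, integral_const_mul, h1]
  unfold PP; ring

lemma PP_eq_of_abs (r a b : ℝ) (hab : |a| = |b|) : b * PP r a - a * PP r b = 0 := by
  by_cases hb : b = 0
  · subst hb
    have : a = 0 := by simpa using hab
    simp [this]
  have ha : a ≠ 0 := by
    rintro rfl; apply hb; simpa using hab.symm
  have h : a * PP r a = b * PP r b := by
    have h1 := PP_tg r a
    have h2 := PP_tg r b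
    have : ∀ y, tg r (a * y) = tg r (b * y) := by
      intro y; rw [← tg_abs r (a * y), ← tg_abs r (b * y), abs_mul, abs_mul, hab]
    simp_rw [this] at h1
    linarith
  have hsq : a ^ 2 = b ^ 2 := by rw [← sq_abs a, ← sq_abs b, hab]
  have : a * (b * PP r a - a * PP r b) = 0 := by
    linear_combination b * h - PP r b * hsq
  exact (mul_eq_zero.1 this).resolve_left ha

lemma PP_zero (r b : ℝ) : b * PP r 0 - 0 * PP r b = 0 := by
  have : PP r 0 = 0 := by
    unfold PP
    simp only [zero_mul, add_zero]
    rw [integral_const_mul]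
    simp
  rw [this]; ring

lemma PP_pos (r a b : ℝ) (hb : b ≠ 0) (hab : |b| < |a|) : 0 < a * b * (b * PP r a - a * PP r b) := by
  have h1 := PP_tg r a
  have h2 := PP_tg r b
  have ha : a ≠ 0 := by rintro rfl; simp at hab; linarith [abs_nonneg b]
  have e : 2 * (a * b * (b * PP r a - a * PP r b)) =
      ∫ y, (b ^ 2 * tg r (a * y) - a ^ 2 * tg r (b * y)) ∂(gaussianReal 0 1) := by
    rw [integral_sub ((tg_int r a).const_mul _) ((tg_int r b).const_mul _), integral_const_mul,
      integral_const_mul, ← h1, ← h2]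
    ring
  have hnn : ∀ y, 0 ≤ b ^ 2 * tg r (a * y) - a ^ 2 * tg r (b * y) := by
    intro y
    by_cases hy : y = 0
    · subst hy; simp [tg]
    have := tg_mono r (b * y) (a * y) (by rw [abs_mul, abs_mul]; gcongr)
    have hy2 : 0 < y ^ 2 := by positivity
    have : 0 ≤ y ^ 2 * (b ^ 2 * tg r (a * y) - a ^ 2 * tg r (b * y)) := by nlinarith
    exact nonneg_of_mul_nonneg_right this hy2
  have hpos : ∀ y, |r| / |a| < y → 0 < b ^ 2 * tg r (a * y) - a ^ 2 * tg r (b * y) := by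
    intro y hy
    have hy0 : 0 < y := lt_of_le_of_lt (by positivity) hy
    have ha' : 0 < |a| := abs_pos.2 ha
    have := tg_strict r (b * y) (a * y) (by rw [abs_mul, abs_mul, abs_of_pos hy0]; gcongr)
      (by positivity) (by rw [abs_mul, abs_of_pos hy0]; rw [div_lt_iff₀ ha'] at hy; linarith)
    have hy2 : 0 < y ^ 2 := by positivity
    have : 0 < y ^ 2 * (b ^ 2 * tg r (a * y) - a ^ 2 * tg r (b * y)) := by nlinarith
    exact pos_of_mul_pos_right this hy2.le
  have : 0 < ∫ y, (b ^ 2 * tg r (a * y) - a ^ 2 * tg r (b * y)) ∂(gaussianReal 0 1) := by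
    rw [integral_pos_iff_support_of_nonneg hnn (((tg_int r a).const_mul _).sub ((tg_int r b).const_mul _))]
    have hsub : Set.Ioi (|r| / |a|) ⊆ Function.support
        (fun y => b ^ 2 * tg r (a * y) - a ^ 2 * tg r (b * y)) := fun y hy => (hpos y hy).ne'
    refine lt_of_lt_of_le ?_ (measure_mono hsub)
    rw [pos_iff_ne_zero]
    intro h0
    have := gaussianReal_absolutelyContinuous' 0 (v := 1) (by simp) h0
    simp at this
  linarith

lemma mp_update {N : ℕ} (μ : Measure ℝ) [IsProbabilityMeasure μ] (j : Fin N) :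
    MeasurePreserving (fun p : (Fin N → ℝ) × ℝ => Function.update p.1 j p.2)
      ((Measure.pi fun _ => μ).prod μ) (Measure.pi fun _ => μ) := by
  have hm : Measurable (fun p : (Fin N → ℝ) × ℝ => Function.update p.1 j p.2) := by
    rw [measurable_pi_iff]
    intro i
    by_cases h : i = j
    · subst h; simp; fun_prop
    · simp [Function.update_of_ne h]; fun_prop
  refine ⟨hm, ?_⟩
  symm
  refine Measure.pi_eq fun s hs => ?_
  rw [Measure.map_apply hm (MeasurableSet.univ_pi hs)]
  have : (fun p : (Fin N → ℝ) × ℝ => Function.update p.1 j p.2) ⁻¹' (Set.univ.pi s)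
      = (Set.univ.pi (Function.update s j Set.univ)) ×ˢ (s j) := by
    ext p
    simp only [Set.mem_preimage, Set.mem_pi, Set.mem_univ, true_imp_iff, Set.mem_prod]
    constructor
    · intro h
      refine ⟨fun i => ?_, by simpa using h j⟩
      by_cases hi : i = j
      · subst hi; simp
      · simpa [hi] using h i
    · rintro ⟨h, h'⟩ i
      by_cases hi : i = j
      · subst hi; simpa using h'
      · simpa [hi] using h i
  rw [this, Measure.prod_prod, Measure.pi_pi, ← Finset.mul_prod_erase _ _ (Finset.mem_univ j),
    ← Finset.mul_prod_erase (Finset.univ) (fun i => μ (s i)) (Finset.mem_univ j)]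
  simp only [Function.update_self, measure_univ, one_mul]
  rw [mul_comm]
  congr 1
  refine Finset.prod_congr rfl fun i hi => ?_
  rw [Function.update_of_ne (Finset.ne_of_mem_erase hi)]

lemma mp_update2 {N : ℕ} (μ : Measure ℝ) [IsProbabilityMeasure μ] (j k : Fin N) :
    MeasurePreserving (fun p : (Fin N → ℝ) × (ℝ × ℝ) =>
        Function.update (Function.update p.1 j p.2.1) k p.2.2)
      ((Measure.pi fun _ => μ).prod (μ.prod μ)) (Measure.pi fun _ => μ) := by
  have h1 := (mp_update (N := N) μ j).prod (MeasurePreserving.id μ)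
  have h2 := (mp_update (N := N) μ k).comp h1
  have h3 := (measurePreserving_prodAssoc (Measure.pi fun _ : Fin N => μ) μ μ).symm
  exact h2.comp h3

lemma memLp_coord {N : ℕ} {θ : ℝ} (h0 : 0 < θ) (h1 : θ < 1) (j : Fin N) :
    MemLp (fun x : Fin N → ℝ => x j) 3 (bgPi θ N) := by
  have : Fact (0 < θ ∧ θ < 1) := ⟨h0, h1⟩
  exact (memLp_bg θ).comp_measurePreserving (measurePreserving_eval (fun _ : Fin N => bgMeasure θ) j)

lemma popG_int {N : ℕ} {θ : ℝ} (h0 : 0 < θ) (h1 : θ < 1) (d : Fin N → ℝ) (j : Fin N) :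
    Integrable (fun x : Fin N → ℝ => (∑ i, d i * x i) * |∑ i, d i * x i| * x j) (bgPi θ N) :=
  integrable_cub (memLp_finsetSum _ fun i _ => (memLp_coord h0 h1 i).const_mul (d i))
    (memLp_coord h0 h1 j)

lemma key {N : ℕ} {θ : ℝ} (h0 : 0 < θ) (h1 : θ < 1) (d : Fin N → ℝ) (j k : Fin N) (hjk : j ≠ k) :
    ∃ r : (Fin N → ℝ) → ℝ,
      Integrable (fun x => d k * PP (r x) (d j) - d j * PP (r x) (d k)) (bgPi θ N) ∧
      d k * popG θ N d j - d j * popG θ N d k =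
      θ * (1 - θ) * ∫ x, (d k * PP (r x) (d j) - d j * PP (r x) (d k)) ∂(bgPi θ N) := by
  have : Fact (0 < θ ∧ θ < 1) := ⟨h0, h1⟩
  set r : (Fin N → ℝ) → ℝ := fun x => ∑ i ∈ (Finset.univ.erase j).erase k, d i * x i with hr
  set F : (Fin N → ℝ) → ℝ := fun x =>
    (∑ i, d i * x i) * |∑ i, d i * x i| * (d k * x j - d j * x k) with hF
  have hmp := mp_update2 (N := N) (bgMeasure θ) j k
  have hFi : Integrable F (bgPi θ N) :=
    integrable_cub (memLp_finsetSum _ fun i _ => (memLp_coord h0 h1 i).const_mul (d i))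
      (((memLp_coord h0 h1 j).const_mul _).sub ((memLp_coord h0 h1 k).const_mul _))
  have hD : d k * popG θ N d j - d j * popG θ N d k = ∫ x, F x ∂(bgPi θ N) := by
    unfold popG
    rw [← integral_const_mul, ← integral_const_mul, ← integral_sub]
    · congr 1; ext x; simp only [hF]; ring
    · exact (popG_int h0 h1 d j).const_mul _
    · exact (popG_int h0 h1 d k).const_mul _
  have hcomp : ∀ (x : Fin N → ℝ) (p : ℝ × ℝ),
      F (Function.update (Function.update x j p.1) k p.2) =
      (r x + d j * p.1 + d k * p.2) * |r x + d j * p.1 + d k * p.2| * (d k * p.1 - d j * p.2) := by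
    intro x p
    have hs : ∑ i, d i * Function.update (Function.update x j p.1) k p.2 i
        = r x + d j * p.1 + d k * p.2 := by
      rw [← Finset.add_sum_erase _ _ (Finset.mem_univ j),
        ← Finset.add_sum_erase (Finset.univ.erase j) _ (Finset.mem_erase.2 ⟨hjk.symm, Finset.mem_univ k⟩)]
      have : ∑ i ∈ (Finset.univ.erase j).erase k, d i * Function.update (Function.update x j p.1) k p.2 i
          = r x := by
        refine Finset.sum_congr rfl fun i hi => ?_
        simp only [Finset.mem_erase] at hi
        rw [Function.update_of_ne hi.1, Function.update_of_ne hi.2.1]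
      rw [this]
      simp [Function.update_of_ne hjk]
      ring
    simp only [hF]
    rw [hs]
    simp [Function.update_of_ne hjk]
  have hi2 : Integrable (fun p : (Fin N → ℝ) × (ℝ × ℝ) =>
      F (Function.update (Function.update p.1 j p.2.1) k p.2.2))
      ((bgPi θ N).prod ((bgMeasure θ).prod (bgMeasure θ))) :=
    hmp.integrable_comp_of_integrable hFi
  have hint : ∫ x, F x ∂(bgPi θ N) = ∫ p : (Fin N → ℝ) × (ℝ × ℝ),
      F (Function.update (Function.update p.1 j p.2.1) k p.2.2)
      ∂((bgPi θ N).prod ((bgMeasure θ).prod (bgMeasure θ))) := by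
    have hm := hmp.map_eq
    have hFm : AEStronglyMeasurable F (bgPi θ N) := hFi.1
    conv_lhs => rw [bgPi, ← hm]
    rw [integral_map hmp.measurable.aemeasurable (by rw [hm]; exact hFm)]
    rfl
  have : SigmaFinite (bgPi θ N) := by unfold bgPi; infer_instance
  have hleft := hi2.integral_prod_left
  simp only [hcomp, two_int h0 h1] at hleft
  have hne : θ * (1 - θ) ≠ 0 := mul_ne_zero h0.ne' (by linarith)
  refine ⟨r, ?_, ?_⟩
  · refine (hleft.const_mul (θ * (1 - θ))⁻¹).congr (Filter.Eventually.of_forall fun x => ?_)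
    simp only
    rw [← mul_assoc, inv_mul_cancel₀ hne, one_mul]
  · rw [hD, hint, integral_prod _ hi2]
    simp only [hcomp, two_int h0 h1]
    rw [integral_const_mul]

lemma prop_of {N : ℕ} {θ : ℝ} (h0 : 0 < θ) (h1 : θ < 1) (d : Fin N → ℝ) (j k : Fin N)
    (h : d j = 0 ∨ |d j| = |d k|) : d k * popG θ N d j = d j * popG θ N d k := by
  by_cases hjk : j = k
  · subst hjk; rfl
  obtain ⟨r, _, hr⟩ := key h0 h1 d j k hjk
  have : ∀ x, d k * PP (r x) (d j) - d j * PP (r x) (d k) = 0 := by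
    intro x
    rcases h with h | h
    · rw [h]; exact PP_zero _ _
    · exact PP_eq_of_abs _ _ _ h
  simp only [this, integral_zero, mul_zero] at hr
  linarith

lemma strict_of {N : ℕ} {θ : ℝ} (h0 : 0 < θ) (h1 : θ < 1) (d : Fin N → ℝ) (j k : Fin N)
    (hk : d k ≠ 0) (h : |d k| < |d j|) : d k * popG θ N d j ≠ d j * popG θ N d k := by
  have : Fact (0 < θ ∧ θ < 1) := ⟨h0, h1⟩
  have : IsProbabilityMeasure (bgPi θ N) := by unfold bgPi; infer_instance
  have hjk : j ≠ k := by rintro rfl; exact lt_irrefl _ h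
  obtain ⟨r, hi, hr⟩ := key h0 h1 d j k hjk
  have hp : ∀ x, 0 < d j * d k * (d k * PP (r x) (d j) - d j * PP (r x) (d k)) :=
    fun x => PP_pos _ _ _ hk h
  have : 0 < ∫ x, d j * d k * (d k * PP (r x) (d j) - d j * PP (r x) (d k)) ∂(bgPi θ N) := by
    rw [integral_pos_iff_support_of_nonneg (fun x => (hp x).le) (hi.const_mul _)]
    rw [Function.support_eq_univ fun x => (hp x).ne']
    simp
  rw [integral_const_mul] at this
  intro he
  rw [he, sub_self] at hr
  have hne : θ * (1 - θ) ≠ 0 := mul_ne_zero h0.ne' (by linarith)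
  have h3 := (mul_eq_zero.1 hr.symm).resolve_left hne
  rw [h3, mul_zero] at this
  exact lt_irrefl _ this

open scoped Classical in
theorem stmt5 (N : ℕ) (θ : ℝ) (hθ₁ : 1 / (N : ℝ) < θ) (hθ₂ : θ < 1 / 2)
    (d : Fin N → ℝ) (hd : ∑ i, d i ^ 2 = 1) :
    ((∀ j, popG θ N d j - d j * ∑ k, d k * popG θ N d k = 0) ↔ d ∈ Sprime N) ∧
    (Sprime N).Finite ∧
    (∀ d' : Fin N → ℝ,
      (∃ v : Fin N → ℝ, (∀ i, v i = -1 ∨ v i = 0 ∨ v i = 1) ∧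
          (Finset.univ.filter fun i => v i ≠ 0).card = 1 ∧
          ∀ i, d' i = v i / Real.sqrt 1) ↔
        ∃ n : Fin N, (∀ i, d' i = if i = n then 1 else 0) ∨
          (∀ i, d' i = if i = n then -1 else 0)) := by
  have h0 : 0 < θ := lt_of_le_of_lt (by positivity) hθ₁
  have h1 : θ < 1 := by linarith
  obtain ⟨k0, hk0⟩ : ∃ k, d k ≠ 0 := by
    by_contra! h
    simp [h] at hd
  refine ⟨⟨fun h => ?_, ?_⟩, ?_, ?_⟩
  · have habs : ∀ i, d i ≠ 0 → |d i| = |d k0| := by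
      intro i hi
      have hh : ∀ p q, d p * popG θ N d q = d q * popG θ N d p := by
        intro p q
        linear_combination d p * h q - d q * h p
      rcases lt_trichotomy |d i| |d k0| with hl | hl | hl
      · exact absurd (hh i k0) (strict_of h0 h1 d k0 i hi hl)
      · exact hl
      · exact absurd (hh k0 i) (strict_of h0 h1 d i k0 hk0 hl)
    set c := |d k0| with hc
    have hcpos : 0 < c := abs_pos.2 hk0
    set S := Finset.univ.filter fun i => d i ≠ 0 with hS
    have hSpos : 0 < S.card := Finset.card_pos.2 ⟨k0, by simp [hS, hk0]⟩
    have hsum : (S.card : ℝ) * c ^ 2 = 1 := by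
      rw [← hd, ← nsmul_eq_mul, ← Finset.sum_const, hS, Finset.sum_filter]
      refine Finset.sum_congr rfl fun i _ => ?_
      split_ifs with hi
      · rw [← habs i hi, sq_abs]
      · push Not at hi; simp [hi]
    have hsq : c * Real.sqrt S.card = 1 := by
      have : (c * Real.sqrt S.card) ^ 2 = 1 := by
        rw [mul_pow, Real.sq_sqrt (by positivity)]; linarith
      have h2 : 0 ≤ c * Real.sqrt S.card := by positivity
      nlinarith
    have hspos : 0 < Real.sqrt S.card := Real.sqrt_pos.2 (by exact_mod_cast hSpos)
    refine ⟨S.card, Finset.mem_Icc.2 ⟨hSpos, ?_⟩, fun i => d i * Real.sqrt S.card, ?_, ?_, ?_⟩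
    · simpa using Finset.card_le_univ S
    · intro i
      beta_reduce
      by_cases hi : d i = 0
      · simp [hi]
      · have := habs i hi
        rcases abs_cases (d i) with ⟨h', _⟩ | ⟨h', _⟩
        · right; right; rw [← h', this, hsq]
        · left
          have : d i = -c := by linarith
          rw [this]; linarith
    · rw [hS]
      congr 1
      ext i
      simp only [Finset.mem_filter, Finset.mem_univ, true_and, ne_eq, mul_eq_zero, not_or]
      exact ⟨fun h => h.1, fun h => ⟨h, hspos.ne'⟩⟩
    · intro i
      field_simp
  · rintro ⟨k, -, v, hv, -, hdv⟩
    have habs : ∀ i, d i = 0 ∨ |d i| = |d k0| := by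
      have hh : ∀ i, d i ≠ 0 → |d i| = 1 / |Real.sqrt k| := by
        intro i hi
        rw [hdv i, abs_div]
        rcases hv i with h | h | h
        · simp [h]
        · exact absurd (by simp [hdv i, h]) hi
        · simp [h]
      intro i
      by_cases hi : d i = 0
      · exact Or.inl hi
      · exact Or.inr (by rw [hh i hi, hh k0 hk0])
    have hp : ∀ j, popG θ N d j = d j * (popG θ N d k0 / d k0) := by
      intro j
      have := prop_of h0 h1 d j k0 (habs j)
      field_simp
      linarith
    intro j
    generalize popG θ N d k0 / d k0 = L at hp
    have : ∑ k, d k * popG θ N d k = L := by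
      rw [← one_mul L, ← hd, Finset.sum_mul]
      refine Finset.sum_congr rfl fun i _ => ?_
      rw [hp i]; ring
    rw [this, hp j]; ring
  · have hfin : (⋃ k ∈ Finset.Icc 1 N, (fun (v : Fin N → ℝ) i => v i / Real.sqrt k) ''
        (Set.univ.pi fun _ : Fin N => ({-1, 0, 1} : Set ℝ))).Finite := by
      refine Set.Finite.biUnion (Finset.finite_toSet _) fun k _ => ?_
      exact (Set.Finite.pi fun _ => Set.toFinite _).image _
    refine hfin.subset ?_
    rintro e ⟨k, hk, v, hv, -, he⟩
    simp only [Set.mem_iUnion]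
    exact ⟨k, hk, v, fun i _ => by simpa using hv i, funext fun i => (he i).symm⟩
  · intro d'
    constructor
    · rintro ⟨v, hv, hc, hd'⟩
      obtain ⟨n, hn⟩ := Finset.card_eq_one.1 hc
      have hz : ∀ i, i ≠ n → v i = 0 := by
        intro i hi
        by_contra hne
        have : i ∈ Finset.univ.filter fun i => v i ≠ 0 := by simp [hne]
        rw [hn] at this
        exact hi (by simpa using this)
      have hnn : v n ≠ 0 := by
        have : n ∈ Finset.univ.filter fun i => v i ≠ 0 := by rw [hn]; simp
        simpa using this
      refine ⟨n, ?_⟩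
      rcases hv n with h | h | h
      · right; intro i; rw [hd' i]; split_ifs with hi
        · rw [hi, h]; simp
        · simp [hz i hi]
      · exact absurd h hnn
      · left; intro i; rw [hd' i]; split_ifs with hi
        · rw [hi, h]; simp
        · simp [hz i hi]
    · rintro ⟨n, h | h⟩
      · refine ⟨d', fun i => ?_, ?_, fun i => by simp⟩
        · rw [h i]; split_ifs <;> simp
        · rw [Finset.card_eq_one]
          refine ⟨n, ?_⟩
          ext i; simp [h i]
      · refine ⟨d', fun i => ?_, ?_, fun i => by simp⟩
        · rw [h i]; split_ifs <;> simp
        · rw [Finset.card_eq_one]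
          refine ⟨n, ?_⟩
          ext i; simp [h i]
end

section
/- Let x ∈ ℝ^N be a Bernoulli–Gaussian random vector with parameter θ ∈ (0,1). Then for every unit vector d ∈ S^{N−1}, 𝔼[|dᵀx|³] ≤ γ₃ θ, and equality holds if and only if d = ±e_n for some coordinate n ∈ {1,…,N}. Equivalently, the population objective −𝔼[|dᵀx|³] over the unit sphere attains its global minimum value −γ₃θ exactly at the 2N signed standard basis vectors. -/
open MeasureTheory ProbabilityTheory Real

open scoped NNReal ENNReal

lemma gammaThree_pos : 0 < gammaThree := by
  unfold gammaThree; positivity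

/-- The third absolute moment of the standard Gaussian. -/
lemma integral_abs_cube_gaussian :
    ∫ x, |x| ^ 3 ∂(gaussianReal 0 1) = gammaThree := by
  rw [integral_gaussianReal_eq_integral_smul one_ne_zero]
  have h1 : ∀ x : ℝ, gaussianPDFReal 0 1 x • |x| ^ 3 =
      (fun y : ℝ => (√(2 * π))⁻¹ * (y ^ (3 : ℝ) * rexp (-(1 / 2) * y ^ (2 : ℝ)))) |x| := by
    intro x
    have e3 : |x| ^ (3 : ℝ) = |x| ^ 3 := by exact_mod_cast Real.rpow_natCast |x| 3
    have e2 : |x| ^ (2 : ℝ) = x ^ 2 := by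
      rw [← sq_abs x]; exact_mod_cast Real.rpow_natCast |x| 2
    simp only [gaussianPDFReal, smul_eq_mul, e3, e2, NNReal.coe_one, mul_one, sub_zero]
    have : -x ^ 2 / 2 = -(1 / 2) * x ^ 2 := by ring
    rw [this]; ring
  rw [integral_congr_ae (Filter.Eventually.of_forall h1), 
    integral_comp_abs (f := fun y : ℝ =>
      (√(2 * π))⁻¹ * (y ^ (3 : ℝ) * rexp (-(1 / 2) * y ^ (2 : ℝ)))), integral_const_mul,
    integral_rpow_mul_exp_neg_mul_rpow (by norm_num) (by norm_num) (by norm_num)]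
  have g2 : Real.Gamma ((3 + 1) / 2) = 1 := by
    rw [show ((3 : ℝ) + 1) / 2 = 2 by norm_num]; exact Real.Gamma_two
  have p2 : ((1 : ℝ) / 2) ^ (-((3 : ℝ) + 1) / 2) = 4 := by
    rw [show (-((3 : ℝ) + 1) / 2) = ((-2 : ℤ) : ℝ) by norm_num, Real.rpow_intCast]
    norm_num
  rw [g2, p2]
  unfold gammaThree
  rw [Real.sqrt_mul (by norm_num), Real.sqrt_div (by norm_num)]
  have hp : √π ≠ 0 := by positivity
  have h2 : √2 ≠ 0 := by positivity
  field_simp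
  norm_num

lemma lintegral_abs_cube_gaussian :
    ∫⁻ x, ENNReal.ofReal (|x| ^ 3) ∂(gaussianReal 0 1) = ENNReal.ofReal gammaThree := by
  have hi : Integrable (fun x : ℝ => |x| ^ 3) (gaussianReal 0 1) := by
    by_contra h
    have := integral_undef h
    rw [integral_abs_cube_gaussian] at this
    exact gammaThree_pos.ne' this
  rw [← integral_abs_cube_gaussian, ofReal_integral_eq_lintegral_ofReal hi]
  exact Filter.Eventually.of_forall fun x => by positivity

lemma lintegral_abs_cube_gaussian_var (v : ℝ≥0) :
    ∫⁻ x, ENNReal.ofReal (|x| ^ 3) ∂(gaussianReal 0 v) =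
      ENNReal.ofReal (gammaThree * √v ^ 3) := by
  have h : gaussianReal 0 v = (gaussianReal 0 1).map (√(v : ℝ) * ·) := by
    rw [gaussianReal_map_const_mul]
    congr 1
    · simp
    · ext; simp
  rw [h, lintegral_map (by fun_prop) (by fun_prop)]
  have : ∀ x : ℝ, ENNReal.ofReal (|√(v : ℝ) * x| ^ 3) =
      ENNReal.ofReal (√(v : ℝ) ^ 3) * ENNReal.ofReal (|x| ^ 3) := by
    intro x
    rw [← ENNReal.ofReal_mul (by positivity), abs_mul, mul_pow,
      abs_of_nonneg (Real.sqrt_nonneg _)]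
  simp_rw [this]
  rw [lintegral_const_mul _ (by fun_prop), lintegral_abs_cube_gaussian,
    ← ENNReal.ofReal_mul (by positivity), mul_comm]

/-- The averaged value `𝔼 (v + ∑ b_i d_i²)^{3/2}`, over Bernoulli `b`. -/
noncomputable def avgG (θ : ℝ) : (n : ℕ) → (Fin n → ℝ) → ℝ≥0 → ℝ
  | 0, _, v => √(v : ℝ) ^ 3
  | n + 1, d, v => (1 - θ) * avgG θ n (fun i => d i.succ) v +
      θ * avgG θ n (fun i => d i.succ) (v + NNReal.mk (d 0 ^ 2) (sq_nonneg _))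

lemma avgG_nonneg {θ : ℝ} (h0 : 0 < θ) (h1 : θ < 1) (n : ℕ) :
    ∀ (d : Fin n → ℝ) (v : ℝ≥0), 0 ≤ avgG θ n d v := by
  induction n with
  | zero => intro d v; simp only [avgG]; positivity
  | succ n ih =>
    intro d v
    simp only [avgG]
    have := ih (fun i => d i.succ) v
    have := ih (fun i => d i.succ) (v + NNReal.mk (d 0 ^ 2) (sq_nonneg _))
    have : 0 < 1 - θ := by linarith
    positivity

lemma lintegral_step (θ : ℝ) (d : ℝ) (v : ℝ≥0) (h : ℝ → ℝ≥0∞) (hh : Measurable h) :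
    ∫⁻ z, ∫⁻ y, h (z + d * y) ∂(bgMeasure θ) ∂(gaussianReal 0 v) =
      ENNReal.ofReal (1 - θ) * ∫⁻ z, h z ∂(gaussianReal 0 v) +
      ENNReal.ofReal θ * ∫⁻ z, h z ∂(gaussianReal 0 (v + NNReal.mk (d ^ 2) (sq_nonneg _))) := by
  have e : ∀ z, ∫⁻ y, h (z + d * y) ∂(bgMeasure θ) = ENNReal.ofReal (1 - θ) * h z +
      ENNReal.ofReal θ * ∫⁻ y, h (z + y) ∂(gaussianReal 0 (NNReal.mk (d ^ 2) (sq_nonneg _))) := by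
    intro z
    have hm : gaussianReal 0 (NNReal.mk (d ^ 2) (sq_nonneg _)) =
        (gaussianReal 0 1).map (d * ·) := by
      rw [gaussianReal_map_const_mul]; simp
    rw [hm, lintegral_map (by fun_prop) (by fun_prop), bgMeasure, lintegral_add_measure,
      lintegral_smul_measure, lintegral_smul_measure, lintegral_dirac]
    simp [ENNReal.smul_def, ENNReal.ofReal]
  simp_rw [e]
  have hmeas : Measurable fun z => ∫⁻ y, h (z + y)
      ∂(gaussianReal 0 (NNReal.mk (d ^ 2) (sq_nonneg _))) :=
    Measurable.lintegral_prod_right' (f := fun p : ℝ × ℝ => h (p.1 + p.2)) (by fun_prop)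
  rw [lintegral_add_left (by fun_prop), lintegral_const_mul _ hh, lintegral_const_mul _ hmeas]
  have hc := gaussianReal_conv_gaussianReal (m₁ := 0) (m₂ := 0) (v₁ := v)
    (v₂ := NNReal.mk (d ^ 2) (sq_nonneg _))
  rw [add_zero] at hc
  rw [← hc, Measure.lintegral_conv hh]

lemma lintegral_bgPi {θ : ℝ} (h0 : 0 < θ) (h1 : θ < 1) (n : ℕ) :
    ∀ (d : Fin n → ℝ) (v : ℝ≥0),
      ∫⁻ z, ∫⁻ x, ENNReal.ofReal (|z + ∑ i, d i * x i| ^ 3) ∂(bgPi θ n) ∂(gaussianReal 0 v) =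
        ENNReal.ofReal (gammaThree * avgG θ n d v) := by
  induction n with
  | zero =>
    intro d v
    simp only [avgG, bgPi, Finset.univ_eq_empty, Finset.sum_empty, add_zero]
    rw [← lintegral_abs_cube_gaussian_var]
    simp
  | succ n ih =>
    intro d v
    set h : ℝ → ℝ≥0∞ := fun t =>
      ∫⁻ x, ENNReal.ofReal (|t + ∑ i : Fin n, d i.succ * x i| ^ 3) ∂(bgPi θ n) with hdef
    have : SigmaFinite (bgPi θ n) := by unfold bgPi; infer_instance
    have hh : Measurable h :=
      Measurable.lintegral_prod_right'
        (f := fun p : ℝ × (Fin n → ℝ) => ENNReal.ofReal (|p.1 + ∑ i, d i.succ * p.2 i| ^ 3))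
        (by fun_prop)
    have key : ∀ z, ∫⁻ x, ENNReal.ofReal (|z + ∑ i, d i * x i| ^ 3) ∂(bgPi θ (n + 1)) =
        ∫⁻ y, h (z + d 0 * y) ∂(bgMeasure θ) := by
      intro z
      have mp := (measurePreserving_piFinSuccAbove (fun _ : Fin (n + 1) => bgMeasure θ) 0).symm
      rw [bgPi, ← mp.lintegral_comp (by fun_prop), lintegral_prod _ (by fun_prop)]
      simp [hdef, bgPi, Fin.sum_univ_succ, add_assoc]
    simp_rw [key]
    rw [lintegral_step θ (d 0) v h hh, hdef, ih, ih]
    have g := gammaThree_pos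
    have a1 := avgG_nonneg h0 h1 n (fun i => d i.succ) v
    have a2 := avgG_nonneg h0 h1 n (fun i => d i.succ) (v + NNReal.mk (d 0 ^ 2) (sq_nonneg _))
    have : 0 < 1 - θ := by linarith
    rw [← ENNReal.ofReal_mul (by positivity), ← ENNReal.ofReal_mul (by positivity),
      ← ENNReal.ofReal_add (by positivity) (by positivity)]
    congr 1
    simp only [avgG]; ring

lemma sqrt_cube_le {v : ℝ} (h0 : 0 ≤ v) (h1 : v ≤ 1) :
    √v ^ 3 ≤ v ∧ (√v ^ 3 = v → v = 0 ∨ v = 1) := by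
  have hs := Real.sq_sqrt h0
  have hn := Real.sqrt_nonneg v
  have hl : √v ≤ 1 := Real.sqrt_le_one.mpr h1
  constructor
  · nlinarith [mul_nonneg (mul_nonneg hn hn) (sub_nonneg.mpr hl)]
  · intro h
    have h3 : √v ^ 2 * (√v - 1) = 0 := by linear_combination h - hs
    rcases mul_eq_zero.mp h3 with h4 | h4
    · left; rw [← hs, h4]
    · right; rw [← hs, sub_eq_zero.mp h4]; norm_num

lemma avgG_bound {θ : ℝ} (h0 : 0 < θ) (h1 : θ < 1) (n : ℕ) :
    ∀ (d : Fin n → ℝ) (v : ℝ≥0), v + ∑ i, d i ^ 2 ≤ (1 : ℝ) →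
      avgG θ n d v ≤ v + θ * ∑ i, d i ^ 2 ∧
      (avgG θ n d v = v + θ * ∑ i, d i ^ 2 →
        ((v : ℝ) = 0 ∨ (v : ℝ) = 1) ∧ ∀ i, v + d i ^ 2 = 0 ∨ v + d i ^ 2 = 1) := by
  induction n with
  | zero =>
    intro d v hv
    simp only [avgG, Finset.univ_eq_empty, Finset.sum_empty, mul_zero, add_zero] at hv ⊢
    have := sqrt_cube_le v.coe_nonneg hv
    exact ⟨this.1, fun h => ⟨this.2 h, fun i => i.elim0⟩⟩
  | succ n ih =>
    intro d v hv
    rw [Fin.sum_univ_succ] at hv ⊢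
    obtain ⟨A, A'⟩ := ih (fun i => d i.succ) v (by nlinarith [sq_nonneg (d 0)])
    obtain ⟨B, B'⟩ := ih (fun i => d i.succ) (v + NNReal.mk (d 0 ^ 2) (sq_nonneg _))
      (by rw [NNReal.coe_add, NNReal.coe_mk]; linarith)
    simp only [avgG]
    simp only [NNReal.coe_add, NNReal.coe_mk] at B B'
    set a := avgG θ n (fun i => d i.succ) v
    set b := avgG θ n (fun i => d i.succ) (v + NNReal.mk (d 0 ^ 2) (sq_nonneg _))
    set S := ∑ i : Fin n, d i.succ ^ 2
    have h1' : 0 < 1 - θ := by linarith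
    have A1 := mul_le_mul_of_nonneg_left A h1'.le
    have B1 := mul_le_mul_of_nonneg_left B h0.le
    refine ⟨by linarith, fun h => ?_⟩
    have A2 : (1 - θ) * a = (1 - θ) * (v + θ * S) := by linarith
    have B2 : θ * b = θ * (v + d 0 ^ 2 + θ * S) := by linarith
    obtain ⟨p, q⟩ := A' (mul_left_cancel₀ h1'.ne' A2)
    obtain ⟨r, -⟩ := B' (mul_left_cancel₀ h0.ne' B2)
    exact ⟨p, Fin.cases r q⟩

lemma avgG_zero {θ : ℝ} (n : ℕ) :
    ∀ (d : Fin n → ℝ) (v : ℝ≥0), (∀ i, d i = 0) → avgG θ n d v = √(v : ℝ) ^ 3 := by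
  induction n with
  | zero => intro d v _; rfl
  | succ n ih =>
    intro d v h
    have : NNReal.mk (d 0 ^ 2) (sq_nonneg _) = 0 := by ext; simp [h 0]
    simp only [avgG, this, add_zero]
    rw [ih _ _ fun i => h i.succ]; ring

lemma avgG_single {θ : ℝ} (n : ℕ) :
    ∀ (d : Fin n → ℝ) (m : Fin n), d m ^ 2 = 1 → (∀ i, i ≠ m → d i = 0) →
      avgG θ n d 0 = θ := by
  induction n with
  | zero => intro d m; exact m.elim0
  | succ n ih =>
    intro d m hm h
    simp only [avgG]
    rcases Fin.eq_zero_or_eq_succ m with rfl | ⟨k, rfl⟩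
    · have h' : ∀ i : Fin n, d i.succ = 0 := fun i => h _ (Fin.succ_ne_zero i)
      rw [avgG_zero _ _ _ h', avgG_zero _ _ _ h']
      simp [hm]
    · have : NNReal.mk (d 0 ^ 2) (sq_nonneg _) = 0 := by
        ext; simp [h 0 (Fin.succ_ne_zero k).symm]
      rw [this, add_zero, ih _ k hm fun i hi => h _ (by simpa using hi)]; ring

lemma integral_bgPi {θ : ℝ} (h0 : 0 < θ) (h1 : θ < 1) (n : ℕ) (d : Fin n → ℝ) :
    (∫ x, |∑ i, d i * x i| ^ 3 ∂ bgPi θ n) = gammaThree * avgG θ n d 0 := by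
  have h := lintegral_bgPi h0 h1 n d 0
  have : SigmaFinite (bgPi θ n) := by unfold bgPi; infer_instance
  rw [gaussianReal_zero_var, lintegral_dirac] at h
  simp only [zero_add] at h
  rw [integral_eq_lintegral_of_nonneg_ae (Filter.Eventually.of_forall fun x => by positivity)
    (Measurable.aestronglyMeasurable (by fun_prop)), h, ENNReal.toReal_ofReal]
  exact mul_nonneg gammaThree_pos.le (avgG_nonneg h0 h1 _ _ _)

/-- For x ~ BG(θ) and every unit vector d, 𝔼[|dᵀx|³] ≤ γ₃θ, with
equality iff d = ±e_n for some n; i.e. the population objective −𝔼[|dᵀx|³] attains its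
global minimum −γ₃θ over the unit sphere exactly at the 2N signed standard basis
vectors. -/
theorem stmt6 (N : ℕ) (θ : ℝ) (hθ : θ ∈ Set.Ioo (0 : ℝ) 1)
    (d : Fin N → ℝ) (hd : ∑ i, d i ^ 2 = 1) :
    (∫ x, |∑ i, d i * x i| ^ 3 ∂ bgPi θ N) ≤ gammaThree * θ ∧
    ((∫ x, |∑ i, d i * x i| ^ 3 ∂ bgPi θ N) = gammaThree * θ ↔
      ∃ n : Fin N, (∀ i, d i = if i = n then 1 else 0) ∨
        (∀ i, d i = if i = n then -1 else 0)) := by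
  obtain ⟨h0, h1⟩ := hθ
  have g := gammaThree_pos
  rw [integral_bgPi h0 h1]
  obtain ⟨A, B⟩ := avgG_bound h0 h1 N d 0 (by simp [hd])
  simp only [NNReal.coe_zero, zero_add, hd, mul_one] at A B
  refine ⟨mul_le_mul_of_nonneg_left A g.le, fun h => ?_, ?_⟩
  · obtain ⟨-, C⟩ := B (mul_left_cancel₀ g.ne' h)
    have hex : ∃ n, d n ^ 2 = 1 := by
      by_contra hne
      push Not at hne
      have : ∑ i, d i ^ 2 = 0 := Finset.sum_eq_zero fun i _ => (C i).resolve_right (hne i)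
      linarith
    obtain ⟨n, hn⟩ := hex
    have hz : ∀ i, i ≠ n → d i = 0 := by
      intro i hi
      rw [← Finset.add_sum_erase _ _ (Finset.mem_univ n), hn] at hd
      have hs : ∑ i ∈ Finset.univ.erase n, d i ^ 2 = 0 := by linarith
      rw [Finset.sum_eq_zero_iff_of_nonneg (fun i _ => sq_nonneg _)] at hs
      exact pow_eq_zero_iff (two_ne_zero) |>.mp (hs i (by simp [hi]))
    refine ⟨n, ?_⟩
    rcases (show d n = 1 ∨ d n = -1 by simpa using hn) with h | h
    · left; intro i; split_ifs with hi
      · rw [hi, h]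
      · exact hz i hi
    · right; intro i; split_ifs with hi
      · rw [hi, h]
      · exact hz i hi
  · rintro ⟨n, h | h⟩
    · rw [avgG_single N d n (by rw [h n]; simp) fun i hi => by rw [h i]; simp [hi]]
    · rw [avgG_single N d n (by rw [h n]; simp) fun i hi => by rw [h i]; simp [hi]]
end

section
/- (Benign global geometry of the population problem.) Let x ∈ ℝ^N be Bernoulli–Gaussian with parameter θ ∈ (1/N, 1/2), let ζ₀ ∈ (0,1), and let F(d) = −𝔼[|dᵀx|³]. Then for every d in the good subset S_{ζ₀}^{(N+)} and every index n' ≠ N with d_{n'} ≠ 0, the negative Riemannian gradient satisfies ⟨ −(I − d dᵀ)∇F(d), (1/d_N) e_N − (1/d_{n'}) e_{n'} ⟩ ≥ (3γ₃ / (2N)) · θ(1−θ) · ζ₀/(1+ζ₀), and by symmetry the analogous statement holds simultaneously for all 2N subsets S_{ζ₀}^{(n±)}, n ∈ {1,…,N}. -/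
open MeasureTheory ProbabilityTheory Real

/-- The j-th coordinate of the negative Riemannian gradient
−(I − ddᵀ)∇F(d) = 3(I − ddᵀ)𝔼[(dᵀx)|dᵀx|x] of the population objective. -/
noncomputable def popNegRGrad (θ : ℝ) (N : ℕ) (d : Fin N → ℝ) (j : Fin N) : ℝ :=
  3 * (popG θ N d j - d j * ∑ k, d k * popG θ N d k)

/-- Membership in the good subset S_ζ^{(n,s)} (s = +1 or −1): d is a unit vector,
s·d_n > 0, and d_n²/‖d_{−n}‖_∞² ≥ 1+ζ, i.e. (1+ζ) d_j² ≤ d_n² for all j ≠ n. -/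
def goodSet (N : ℕ) (ζ : ℝ) (n : Fin N) (s : ℝ) (d : Fin N → ℝ) : Prop :=
  (∑ i, d i ^ 2 = 1) ∧ 0 < s * d n ∧ ∀ j ≠ n, (1 + ζ) * d j ^ 2 ≤ d n ^ 2


lemma aux_third : ∫ t, |t| ^ 3 ∂(gaussianReal 0 1) = gammaThree := by
  rw [integral_gaussianReal_eq_integral_smul (by norm_num)]
  have h1 : ∀ t : ℝ, gaussianPDFReal 0 1 t • |t| ^ 3 =
      (fun u : ℝ => (√(2 * π))⁻¹ * (u ^ (3:ℝ) * exp (-(1/2) * u ^ (2:ℝ)))) |t| := by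
    intro t
    have e1 : |t| ^ (3:ℝ) = |t| ^ 3 := by exact_mod_cast Real.rpow_natCast |t| 3
    have e2 : |t| ^ (2:ℝ) = t ^ 2 := by rw [← sq_abs]; exact_mod_cast Real.rpow_natCast |t| 2
    simp only [e1, e2]
    simp only [gaussianPDFReal, smul_eq_mul, NNReal.coe_one, mul_one, sub_zero]
    rw [show -t ^ 2 / 2 = -(1/2) * t ^ 2 by ring]; ring
  simp_rw [h1]
  rw [integral_comp_abs (f := fun u : ℝ => (√(2 * π))⁻¹ * (u ^ (3:ℝ) * exp (-(1/2) * u ^ (2:ℝ)))), integral_const_mul,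
    integral_rpow_mul_exp_neg_mul_rpow (by norm_num) (by norm_num) (by norm_num)]
  have : ((3:ℝ) + 1) / 2 = 2 := by norm_num
  rw [neg_div, this, Real.Gamma_two]
  have e : ((1:ℝ)/2) ^ (-(2:ℝ)) = 4 := by
    rw [Real.rpow_neg (by norm_num)]
    norm_num
  rw [e, gammaThree, Real.sqrt_div (by norm_num), Real.sqrt_mul (by norm_num)]
  have h2 : √(2:ℝ) ^ 2 = 2 := Real.sq_sqrt (by norm_num)
  have h3 : √(2:ℝ) > 0 := by positivity
  have h4 : √π > 0 := by positivity
  field_simp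
  nlinarith

section
open scoped RealInnerProductSpace
variable {N : ℕ}

abbrev EE (N : ℕ) := EuclideanSpace ℝ (Fin N)

lemma aux_int (w v : EE N) :
    Integrable (fun g : EE N => ⟪w, g⟫ * |⟪w, g⟫| * ⟪v, g⟫) (stdGaussian (EE N)) := by
  have h (w : EE N) (p : ENNReal) (hp : p ≠ ⊤) : MemLp (fun g : EE N => ⟪w, g⟫) p (stdGaussian (EE N)) :=
    IsGaussian.memLp_dual (stdGaussian (EE N)) (innerSL ℝ w) p hp
  have h4 := h w 4 (by norm_num)
  have : ENNReal.HolderTriple 4 4 2 := ⟨by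
    rw [← two_mul, show (4:ENNReal) = 2 * 2 by norm_num, ENNReal.mul_inv (by simp) (by simp), ← mul_assoc,
      ENNReal.mul_inv_cancel (by simp) (by simp), one_mul]⟩
  have h5 : MemLp (fun g : EE N => ⟪w, g⟫ * |⟪w, g⟫|) 2 (stdGaussian (EE N)) :=
    h4.abs.mul' (p := 4) (q := 4) h4
  exact h5.integrable_mul (h v 2 (by norm_num))

lemma aux_cube (w : EE N) :
    ∫ g, ⟪w, g⟫ * |⟪w, g⟫| * ⟪w, g⟫ ∂(stdGaussian (EE N)) = gammaThree * ‖w‖ ^ 3 := by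
  have h1 : (stdGaussian (EE N)).map (innerSL ℝ w) = (gaussianReal 0 1).map (fun t => ‖w‖ * t) := by
    rw [IsGaussian.map_eq_gaussianReal, integral_strongDual_stdGaussian, variance_dual_stdGaussian,
      gaussianReal_map_const_mul]
    simp
    congr 1
    ext
    simp
  have h2 : ∀ g : EE N, ⟪w, g⟫ * |⟪w, g⟫| * ⟪w, g⟫ = (fun t => |t| ^ 3) (innerSL ℝ w g) := by
    intro g
    simp only [innerSL_apply_apply]
    rw [pow_succ, sq_abs]; ring
  simp_rw [h2]
  rw [← integral_map (φ := innerSL ℝ w) (f := fun t => |t| ^ 3) (by fun_prop) (by fun_prop), h1,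
    integral_map (by fun_prop) (by fun_prop)]
  simp_rw [abs_mul, mul_pow]
  rw [integral_const_mul, aux_third, abs_norm, mul_comm]

lemma aux_phi (w v : EE N) :
    ∫ g, ⟪w, g⟫ * |⟪w, g⟫| * ⟪v, g⟫ ∂(stdGaussian (EE N)) = gammaThree * ‖w‖ * ⟪w, v⟫ := by
  by_cases hw : w = 0
  · simp [hw]
  set R := (ℝ ∙ w).reflection with hR
  have hRw : R w = w := Submodule.reflection_mem_subspace_eq_self (Submodule.mem_span_singleton_self w)
  have hsymm : ∀ a b : EE N, ⟪a, R b⟫ = ⟪R a, b⟫ := by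
    intro a b
    rw [← R.inner_map_map a (R b)]
    simp [hR]
  have h1 : ∫ g, ⟪w, g⟫ * |⟪w, g⟫| * ⟪v, g⟫ ∂(stdGaussian (EE N))
      = ∫ g, ⟪w, g⟫ * |⟪w, g⟫| * ⟪R v, g⟫ ∂(stdGaussian (EE N)) := by
    conv_lhs => rw [← stdGaussian_map R]
    rw [integral_map (by fun_prop) (by fun_prop)]
    simp_rw [hsymm, hRw]
  have h2 : v + R v = (2 * (⟪w, v⟫ / ‖w‖ ^ 2)) • w := by
    rw [hR, Submodule.reflection_apply, Submodule.starProjection_singleton]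
    simp [mul_smul, two_smul]
  have h3 : ∫ g, ⟪w, g⟫ * |⟪w, g⟫| * ⟪v, g⟫ ∂(stdGaussian (EE N))
      + ∫ g, ⟪w, g⟫ * |⟪w, g⟫| * ⟪R v, g⟫ ∂(stdGaussian (EE N))
      = (2 * (⟪w, v⟫ / ‖w‖ ^ 2)) * (gammaThree * ‖w‖ ^ 3) := by
    rw [← integral_add (aux_int _ _) (aux_int _ _), ← aux_cube, ← integral_const_mul]
    congr 1
    ext g
    rw [← mul_add, ← inner_add_left, h2, real_inner_smul_left]; ring
  rw [← h1] at h3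
  have : ‖w‖ ≠ 0 := by simpa using hw
  field_simp at h3 ⊢
  linarith

lemma aux_pi_inner (w : Fin N → ℝ) (g : Fin N → ℝ) :
    (∑ i, w i * g i) = ⟪(WithLp.toLp 2 w : EE N), WithLp.toLp 2 g⟫ := by
  simp [PiLp.inner_apply, mul_comm]

lemma aux_pi (w : Fin N → ℝ) (j : Fin N) :
    ∫ g, (∑ i, w i * g i) * |∑ i, w i * g i| * g j ∂(Measure.pi fun _ : Fin N => gaussianReal 0 1)
      = gammaThree * √(∑ i, w i ^ 2) * w j ∧
    Integrable (fun g => (∑ i, w i * g i) * |∑ i, w i * g i| * g j)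
      (Measure.pi fun _ : Fin N => gaussianReal 0 1) := by
  have key : (fun g : Fin N → ℝ => (∑ i, w i * g i) * |∑ i, w i * g i| * g j) =
      (fun g : EE N => ⟪(WithLp.toLp 2 w : EE N), g⟫ * |⟪(WithLp.toLp 2 w : EE N), g⟫| *
        ⟪(EuclideanSpace.single j 1 : EE N), g⟫) ∘ (WithLp.toLp 2) := by
    ext g
    simp only [aux_pi_inner, Function.comp]
    congr 1
    simp [EuclideanSpace.inner_single_left]
  constructor
  · rw [key]
    have hm : Measurable (WithLp.toLp 2 : (Fin N → ℝ) → EE N) := by fun_prop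
    refine (integral_map (μ := Measure.pi fun _ : Fin N => gaussianReal 0 1) hm.aemeasurable
      (f := (fun g : EE N => ⟪(WithLp.toLp 2 w : EE N), g⟫ * |⟪(WithLp.toLp 2 w : EE N), g⟫| *
        ⟪(EuclideanSpace.single j 1 : EE N), g⟫)) (by fun_prop)).symm.trans ?_
    rw [map_pi_eq_stdGaussian, aux_phi]
    simp [EuclideanSpace.norm_eq, EuclideanSpace.inner_single_right]
  · rw [key, ← integrable_map_measure (by fun_prop) (by fun_prop), map_pi_eq_stdGaussian]
    exact aux_int _ _

end

noncomputable def bern (θ : ℝ) : Measure Bool :=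
  (1 - θ).toNNReal • Measure.dirac false + θ.toNNReal • Measure.dirac true

def cc (b : Bool) : ℝ := if b then 1 else 0

lemma cc_sq (b : Bool) : cc b ^ 2 = cc b := by cases b <;> simp [cc]

lemma cc_meas : Measurable cc := measurable_of_countable _

lemma bern_prob (θ : ℝ) (h0 : 0 ≤ θ) (h1 : θ ≤ 1) : IsProbabilityMeasure (bern θ) := by
  constructor
  simp only [bern, Measure.add_apply, Measure.smul_apply, measure_univ]
  rw [← add_smul, ← Real.toNNReal_add (by linarith) h0]
  simp

lemma bg_eq (θ : ℝ) (h0 : 0 ≤ θ) (h1 : θ ≤ 1) :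
    bgMeasure θ = ((bern θ).prod (gaussianReal 0 1)).map (fun p => cc p.1 * p.2) := by
  have hm : Measurable (fun p : Bool × ℝ => cc p.1 * p.2) :=
    (cc_meas.comp measurable_fst).mul measurable_snd
  ext s hs
  rw [Measure.map_apply hm hs, Measure.prod_apply (hm hs)]
  simp only [bern, bgMeasure]
  rw [lintegral_add_measure, lintegral_smul_measure, lintegral_smul_measure]
  simp only [lintegral_dirac, Measure.add_apply, Measure.smul_apply]
  congr 2
  · rw [Measure.dirac_apply' _ hs]
    have hpre : (Prod.mk false ⁻¹' ((fun p : Bool × ℝ => cc p.1 * p.2) ⁻¹' s)) = {_t : ℝ | (0:ℝ) ∈ s} := by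
      ext t
      simp [cc]
    rw [hpre]
    by_cases h : (0:ℝ) ∈ s <;> simp [h]
  · congr 1
    ext t
    simp [cc]

lemma bgPi_eq (θ : ℝ) (N : ℕ) (h0 : 0 ≤ θ) (h1 : θ ≤ 1) :
    bgPi θ N = ((Measure.pi fun _ : Fin N => bern θ).prod
      (Measure.pi fun _ : Fin N => gaussianReal 0 1)).map (fun p i => cc (p.1 i) * p.2 i) := by
  have := bern_prob θ h0 h1
  have hm : Measurable (fun p : Bool × ℝ => cc p.1 * p.2) :=
    (cc_meas.comp measurable_fst).mul measurable_snd
  have hp : IsProbabilityMeasure (((bern θ).prod (gaussianReal 0 1)).map (fun p => cc p.1 * p.2)) :=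
    Measure.isProbabilityMeasure_map hm.aemeasurable
  have hp2 := measurePreserving_arrowProdEquivProdArrow Bool ℝ (Fin N) (fun _ => bern θ)
    (fun _ => gaussianReal 0 1)
  rw [← hp2.map_eq, Measure.map_map _ hp2.measurable]
  · unfold bgPi
    simp_rw [bg_eq θ h0 h1]
    rw [← Measure.pi_map_pi (fun _ => hm.aemeasurable)]
    rfl
  · refine measurable_pi_lambda _ fun i => ?_
    exact (cc_meas.comp ((measurable_pi_apply i).comp measurable_fst)).mul
      ((measurable_pi_apply i).comp measurable_snd)

lemma popG_eq (θ : ℝ) (N : ℕ) (h0 : 0 ≤ θ) (h1 : θ ≤ 1) (d : Fin N → ℝ) (j : Fin N) :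
    popG θ N d j = gammaThree * d j * ∫ b, cc (b j) * √(∑ i, d i ^ 2 * cc (b i))
      ∂(Measure.pi fun _ : Fin N => bern θ) := by
  have := bern_prob θ h0 h1
  have hm : Measurable (fun (p : (Fin N → Bool) × (Fin N → ℝ)) i => cc (p.1 i) * p.2 i) := by
    refine measurable_pi_lambda _ fun i => ?_
    exact (cc_meas.comp ((measurable_pi_apply i).comp measurable_fst)).mul
      ((measurable_pi_apply i).comp measurable_snd)
  have hf : Measurable (fun x : Fin N → ℝ => (∑ i, d i * x i) * |∑ i, d i * x i| * x j) := by
    fun_prop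
  unfold popG
  rw [bgPi_eq θ N h0 h1, integral_map hm.aemeasurable hf.aestronglyMeasurable]
  have e : ∀ (b : Fin N → Bool) (g : Fin N → ℝ),
      (∑ i, d i * (cc (b i) * g i)) * |∑ i, d i * (cc (b i) * g i)| * (cc (b j) * g j) =
      cc (b j) * ((∑ i, (d i * cc (b i)) * g i) * |∑ i, (d i * cc (b i)) * g i| * g j) := by
    intro b g
    simp_rw [mul_assoc]
    ring
  rw [integral_prod]
  · rw [← integral_const_mul]
    congr 1
    ext b
    simp only [e]
    rw [integral_const_mul, (aux_pi _ j).1]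
    simp_rw [mul_pow, cc_sq]
    linear_combination (gammaThree * d j * √(∑ i, d i ^ 2 * cc (b i))) * cc_sq (b j)
  · refine (integrable_prod_iff (hf.comp hm).aestronglyMeasurable).2 ?_
    refine ⟨Filter.Eventually.of_forall fun b => ?_, Integrable.of_finite⟩
    simp only [Function.comp, e]
    exact (aux_pi _ j).2.const_mul _

lemma bern_int (θ : ℝ) (h0 : 0 ≤ θ) (h1 : θ ≤ 1) (f : Bool → ℝ) :
    ∫ b, f b ∂(bern θ) = (1 - θ) * f false + θ * f true := by
  unfold bern
  rw [integral_add_measure Integrable.of_finite Integrable.of_finite]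
  rw [integral_smul_nnreal_measure, integral_smul_nnreal_measure]
  simp [NNReal.smul_def, h0, h1]

lemma bern_two (θ : ℝ) (N : ℕ) (h0 : 0 ≤ θ) (h1 : θ ≤ 1) (n m : Fin N) (hmn : m ≠ n) :
    ∫ b, cc (b n) * (1 - cc (b m)) ∂(Measure.pi fun _ : Fin N => bern θ) = θ * (1 - θ) := by
  have := bern_prob θ h0 h1
  have h := integral_fintype_prod_eq_prod (𝕜 := ℝ) (μ := fun _ : Fin N => bern θ)
    (fun i b => if i = n then cc b else if i = m then 1 - cc b else 1)
  have e : ∀ F : Fin N → ℝ, (∀ i, i ≠ n → i ≠ m → F i = 1) → ∏ i, F i = F n * F m := by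
    intro F hF
    exact Finset.prod_eq_mul n m hmn.symm (fun i _ h => hF i h.1 h.2) (by simp) (by simp)
  rw [e (fun i => ∫ b, (if i = n then cc b else if i = m then 1 - cc b else 1) ∂(bern θ))] at h
  · simp only [if_true, hmn, if_false, bern_int θ h0 h1] at h
    simp only [cc] at h ⊢
    simp at h
    rw [← h]
    congr 1
    ext b
    rw [e]
    · simp [hmn]
    · intro i h1 h2; simp [h1, h2]
  · intro i h1 h2; simp only [h1, h2, if_false]; rw [integral_const, probReal_univ]; simp

lemma diff_bound (θ : ℝ) (N : ℕ) (h0 : 0 ≤ θ) (h1 : θ ≤ 1) (d : Fin N → ℝ)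
    (hd : ∑ i, d i ^ 2 = 1) (n m : Fin N) (hmn : m ≠ n) (hle : d m ^ 2 ≤ d n ^ 2) :
    θ * (1 - θ) * ((d n ^ 2 - d m ^ 2) / 2) ≤
    ∫ b, cc (b n) * √(∑ i, d i ^ 2 * cc (b i)) ∂(Measure.pi fun _ : Fin N => bern θ) -
    ∫ b, cc (b m) * √(∑ i, d i ^ 2 * cc (b i)) ∂(Measure.pi fun _ : Fin N => bern θ) := by
  have := bern_prob θ h0 h1
  set μ := Measure.pi fun _ : Fin N => bern θ with hμ
  set h : (Fin N → Bool) → ℝ := fun b => √(∑ i, d i ^ 2 * cc (b i)) with hh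
  let σ : (Fin N → Bool) → (Fin N → Bool) := fun b i => b (Equiv.swap n m i)
  have hσ : MeasurePreserving σ μ μ := by
    have := measurePreserving_piCongrLeft (fun _ : Fin N => bern θ) (Equiv.swap n m)
    convert this using 1
    ext b i
    obtain ⟨k, rfl⟩ := (Equiv.swap n m).surjective i
    have := Equiv.piCongrLeft_apply_apply (fun _ : Fin N => Bool) (Equiv.swap n m) b k
    refine Eq.trans ?_ this.symm
    simp [σ]
  have hsw : ∫ b, cc (b m) * (1 - cc (b n)) * h b ∂μ =
      ∫ b, cc (b n) * (1 - cc (b m)) * h (σ b) ∂μ := by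
    conv_lhs => rw [← hσ.map_eq]
    rw [integral_map hσ.measurable.aemeasurable
      (measurable_of_countable _).aestronglyMeasurable]
    simp [σ]
  have hE : ∫ b, cc (b n) * h b ∂μ - ∫ b, cc (b m) * h b ∂μ =
      ∫ b, cc (b n) * (1 - cc (b m)) * (h b - h (σ b)) ∂μ := by
    simp_rw [mul_sub (_ * _)]
    rw [integral_sub Integrable.of_finite Integrable.of_finite, ← hsw,
      ← integral_sub Integrable.of_finite Integrable.of_finite,
      ← integral_sub Integrable.of_finite Integrable.of_finite]
    congr 1
    ext b
    ring
  rw [hE, ← bern_two θ N h0 h1 n m hmn, ← integral_mul_const]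
  refine integral_mono Integrable.of_finite Integrable.of_finite fun b => ?_
  simp only
  cases hn : b n
  · simp [cc]
  cases hm : b m
  swap
  · simp [cc]
  simp only [cc, if_true, sub_zero, one_mul, Bool.false_eq_true, if_false]
  have hrest : ∀ F : Fin N → ℝ, ∑ i, F i = F n + F m + ∑ i ∈ (Finset.univ.erase n).erase m, F i := by
    intro F
    rw [add_assoc, Finset.add_sum_erase _ _ (by simp [hmn]), Finset.add_sum_erase _ _ (by simp)]
  set r := ∑ i ∈ (Finset.univ.erase n).erase m, d i ^ 2 * cc (b i) with hr
  have hr0 : 0 ≤ r := Finset.sum_nonneg fun i _ => by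
    cases b i <;> simp [cc] <;> positivity
  have hr1 : r ≤ ∑ i ∈ (Finset.univ.erase n).erase m, d i ^ 2 := Finset.sum_le_sum fun i _ => by
    cases b i <;> simp [cc] <;> positivity
  have hb : h b = √(d n ^ 2 + r) := by
    simp only [hh]; rw [hrest, hn, hm]; simp [cc, hr]
  have hsb : h (σ b) = √(d m ^ 2 + r) := by
    simp only [hh]; rw [hrest]
    have : ∑ i ∈ (Finset.univ.erase n).erase m, d i ^ 2 * cc (σ b i) = r := by
      refine Finset.sum_congr rfl fun i hi => ?_
      simp at hi
      simp only [σ, Equiv.swap_apply_of_ne_of_ne hi.2 hi.1]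
    rw [this]
    simp [σ, hn, hm, cc]
  rw [hb, hsb]
  have htot := hrest (fun i => d i ^ 2)
  simp only [hd] at htot
  have hA : √(d n ^ 2 + r) ≤ 1 := Real.sqrt_le_one.mpr (by nlinarith [sq_nonneg (d m)])
  have hB : √(d m ^ 2 + r) ≤ √(d n ^ 2 + r) := Real.sqrt_le_sqrt (by linarith)
  have hA2 := Real.sq_sqrt (show 0 ≤ d n ^ 2 + r by positivity)
  have hB2 := Real.sq_sqrt (show 0 ≤ d m ^ 2 + r by positivity)
  nlinarith

/-- benign global geometry of the population problem: for
θ ∈ (1/N, 1/2), ζ₀ ∈ (0,1), simultaneously for all 2N good subsets S_{ζ₀}^{(n±)}: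
for every d ∈ S_{ζ₀}^{(n±)} and every n' ≠ n with d_{n'} ≠ 0,
⟨−∇_grad F(d), (1/d_n)e_n − (1/d_{n'})e_{n'}⟩ ≥ (3γ₃/(2N))·θ(1−θ)·ζ₀/(1+ζ₀). -/
theorem stmt8 (N : ℕ) (θ : ℝ) (hθ₁ : 1 / (N : ℝ) < θ) (hθ₂ : θ < 1 / 2)
    (ζ₀ : ℝ) (hζ : ζ₀ ∈ Set.Ioo (0 : ℝ) 1)
    (n : Fin N) (s : ℝ) (hs : s = 1 ∨ s = -1)
    (d : Fin N → ℝ) (hd : goodSet N ζ₀ n s d)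
    (n' : Fin N) (hn' : n' ≠ n) (hdn' : d n' ≠ 0) :
    popNegRGrad θ N d n / d n - popNegRGrad θ N d n' / d n' ≥
      3 * gammaThree / (2 * N) * (θ * (1 - θ)) * (ζ₀ / (1 + ζ₀)) := by
  obtain ⟨hsum, hpos, hle⟩ := hd
  obtain ⟨hz0, hz1⟩ := hζ
  have hNpos : (0:ℝ) < N := by exact_mod_cast n.pos
  have h0 : 0 ≤ θ := le_trans (by positivity) hθ₁.le
  have h1 : θ ≤ 1 := by linarith
  have hdn : d n ≠ 0 := by
    rintro h
    simp [h] at hpos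
  have hlen := hle n' hn'
  have hle' : ∀ i, d i ^ 2 ≤ d n ^ 2 := by
    intro i
    by_cases h : i = n
    · rw [h]
    · nlinarith [hle i h, sq_nonneg (d i)]
  have hbig : 1 ≤ N * d n ^ 2 := by
    rw [← hsum]
    refine (Finset.sum_le_sum fun i _ => hle' i).trans ?_
    simp
  have hdiff := diff_bound θ N h0 h1 d hsum n n' hn' (hle' n')
  set I : Fin N → ℝ := fun j => ∫ b, cc (b j) * √(∑ i, d i ^ 2 * cc (b i))
      ∂(Measure.pi fun _ : Fin N => bern θ) with hI
  have hG : ∀ j, popG θ N d j = gammaThree * d j * I j := fun j => popG_eq θ N h0 h1 d j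
  have hR : ∀ j, d j ≠ 0 → popNegRGrad θ N d j / d j =
      3 * (gammaThree * I j - ∑ k, d k * popG θ N d k) := by
    intro j hj
    unfold popNegRGrad
    rw [hG j]
    field_simp
  rw [hR n hdn, hR n' hdn']
  have hγ : 0 ≤ gammaThree := by unfold gammaThree; positivity
  have hac : 1 / N * (ζ₀ / (1 + ζ₀)) ≤ d n ^ 2 - d n' ^ 2 := by
    have hA : 1 / (N:ℝ) ≤ d n ^ 2 := by
      rw [div_le_iff₀ hNpos]; linarith
    have hB : d n' ^ 2 ≤ d n ^ 2 / (1 + ζ₀) := by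
      rw [le_div_iff₀ (by linarith)]; linarith
    have hC : d n ^ 2 - d n ^ 2 / (1 + ζ₀) = d n ^ 2 * (ζ₀ / (1 + ζ₀)) := by
      field_simp
      ring
    have hD : 1 / N * (ζ₀ / (1 + ζ₀)) ≤ d n ^ 2 * (ζ₀ / (1 + ζ₀)) :=
      mul_le_mul_of_nonneg_right hA (by positivity)
    linarith
  have hθθ : 0 ≤ θ * (1 - θ) := mul_nonneg h0 (by linarith)
  calc 3 * gammaThree / (2 * N) * (θ * (1 - θ)) * (ζ₀ / (1 + ζ₀))
      = 3 * gammaThree * (θ * (1 - θ) * ((1 / N * (ζ₀ / (1 + ζ₀))) / 2)) := by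
        field_simp
    _ ≤ 3 * gammaThree * (θ * (1 - θ) * ((d n ^ 2 - d n' ^ 2) / 2)) := by gcongr
    _ ≤ 3 * gammaThree * (I n - I n') := by
        gcongr
    _ = _ := by ring
end

section
/- (Concentration of the empirical objective.) There exist positive absolute constants c₁ and C₁ such that the following holds. Let x₁,…,x_L ∈ ℝ^N be i.i.d. Bernoulli–Gaussian vectors with parameter θ ∈ (1/N, 1/2), set y_i = x_i, and let f(d) = −(1/L) Σ_{i=1}^L |dᵀ y_i|³ for d ∈ S^{N−1}. For any δ ∈ (0, c₁ / (N log(L) log(NL) θ^{1/3})^{3/2}) and any L ≥ C₁ δ^{−2} N θ log(Nθ/δ), with probability at least 1 − L^{−1}, sup_{d ∈ S^{N−1}} | f(d) − 𝔼[f(d)] | ≤ δ. -/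
open MeasureTheory ProbabilityTheory Real

/-- The joint law of L i.i.d. samples y_i = x_i, x_i ~ BG(θ)^N (dictionary D* = I). -/
noncomputable def bgSamples (θ : ℝ) (N L : ℕ) : Measure (Fin L → Fin N → ℝ) :=
  Measure.pi fun _ => bgPi θ N

/-- Empirical objective f(d) = −(1/L) Σᵢ |dᵀyᵢ|³. -/
noncomputable def empF (N L : ℕ) (ω : Fin L → Fin N → ℝ) (d : Fin N → ℝ) : ℝ :=
  -((1 : ℝ) / L) * ∑ i, |∑ j, d j * ω i j| ^ 3

/-- Population objective 𝔼[f(d)] = −𝔼[|dᵀx|³]. -/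
noncomputable def popF (θ : ℝ) (N : ℕ) (d : Fin N → ℝ) : ℝ :=
  ∫ x, -|∑ j, d j * x j| ^ 3 ∂ bgPi θ N

lemma bg_prob_s9 {θ : ℝ} (h0 : 0 ≤ θ) (h1 : θ ≤ 1) : IsProbabilityMeasure (bgMeasure θ) := by
  constructor
  simp only [bgMeasure, Measure.add_apply, Measure.smul_apply, measure_univ]
  rw [ENNReal.smul_def, ENNReal.smul_def, smul_eq_mul, smul_eq_mul, mul_one, mul_one,
    ← ENNReal.coe_add, ← Real.toNNReal_add (by linarith) h0]
  simp

lemma bg_integrable {θ : ℝ} {f : ℝ → ℝ} (hf : Integrable f (gaussianReal 0 1)) :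
    Integrable f (bgMeasure θ) := by
  unfold bgMeasure
  refine Integrable.add_measure ?_ ?_
  · exact (integrable_dirac (by simp)).smul_measure_nnreal
  · exact hf.smul_measure_nnreal

lemma bg_integral {θ : ℝ} (h0 : 0 ≤ θ) (h1 : θ ≤ 1) {f : ℝ → ℝ}
    (hf : Integrable f (gaussianReal 0 1)) :
    ∫ x, f x ∂ bgMeasure θ = (1 - θ) * f 0 + θ * ∫ x, f x ∂ gaussianReal 0 1 := by
  unfold bgMeasure
  rw [integral_add_measure (integrable_dirac (by simp)).smul_measure_nnreal
    hf.smul_measure_nnreal, integral_smul_nnreal_measure, integral_smul_nnreal_measure,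
    integral_dirac]
  simp [NNReal.smul_def, h0, h1]

lemma bg_exp_integral {θ : ℝ} (h0 : 0 ≤ θ) (h1 : θ ≤ 1) (t : ℝ) :
    ∫ x, rexp (t * x) ∂ bgMeasure θ = (1 - θ) + θ * rexp (t ^ 2 / 2) := by
  rw [bg_integral h0 h1 (integrable_exp_mul_gaussianReal t)]
  have := mgf_gaussianReal (μ := 0) (v := 1) (p := gaussianReal 0 1) (X := id) (by simp) t
  simp only [mgf, id] at this
  rw [this]; simp

lemma gauss_sq_integrable : Integrable (fun x : ℝ => rexp (x ^ 2 / 4)) (gaussianReal 0 1) := by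
  rw [gaussianReal_of_var_ne_zero _ one_ne_zero,
    integrable_withDensity_iff_integrable_smul' (by fun_prop) (by simp [gaussianPDF])]
  have := (integrable_exp_neg_mul_sq (b := 1/4) (by norm_num)).const_mul (√(2 * π * 1))⁻¹
  refine this.congr (ae_of_all _ fun x => ?_)
  simp only [toReal_gaussianPDF, gaussianPDFReal, smul_eq_mul, NNReal.coe_one]
  rw [mul_assoc _ (rexp _) (rexp _), ← Real.exp_add]
  congr 2; ring

lemma gauss_sq_integral : ∫ x : ℝ, rexp (x ^ 2 / 4) ∂(gaussianReal 0 1) ≤ 2 := by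
  rw [integral_gaussianReal_eq_integral_smul one_ne_zero]
  have : ∀ x : ℝ, gaussianPDFReal 0 1 x • rexp (x ^ 2 / 4)
      = (√(2 * π * 1))⁻¹ * rexp (-(1/4) * x ^ 2) := by
    intro x
    simp only [gaussianPDFReal, smul_eq_mul, NNReal.coe_one]
    rw [mul_assoc, ← Real.exp_add]
    congr 2; ring
  simp_rw [this]
  rw [integral_const_mul, integral_gaussian]
  rw [show π / (1/4) = 2 * (2 * π * 1) by ring, Real.sqrt_mul (by norm_num : (0:ℝ) ≤ 2) (2 * π * 1)]
  have hp : 0 < √(2 * π * 1) := by positivity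
  have h2 : √(2:ℝ) ≤ 2 := by rw [Real.sqrt_le_left (by norm_num)]; norm_num
  calc _ = √2 * ((√(2 * π * 1))⁻¹ * √(2 * π * 1)) := by ring
    _ ≤ 2 := by rw [inv_mul_cancel₀ hp.ne', mul_one]; exact h2

lemma bg_sq_integral {θ : ℝ} (h0 : 0 ≤ θ) (h1 : θ ≤ 1) :
    ∫ x, rexp (x ^ 2 / 4) ∂ bgMeasure θ ≤ rexp θ := by
  rw [bg_integral h0 h1 gauss_sq_integrable]
  have := mul_le_mul_of_nonneg_left gauss_sq_integral h0
  have := Real.add_one_le_exp θ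
  simp; linarith

lemma six_le_cosh (u : ℝ) : u ^ 6 ≤ 720 * (Real.cosh u - 1) := by
  have h := sum_le_hasSum {0, 3} (fun i _ => ?_) (Real.hasSum_cosh u)
  · rw [Finset.sum_pair (by norm_num)] at h
    norm_num [Nat.factorial] at h
    linarith
  · have := (even_two_mul i).pow_nonneg u
    positivity

section
variable {θ : ℝ} {N : ℕ}

lemma bgPi_prob (h0 : 0 ≤ θ) (h1 : θ ≤ 1) : IsProbabilityMeasure (bgPi θ N) := by
  have := bg_prob_s9 h0 h1
  unfold bgPi; infer_instance

lemma pi_sq_eq (x : Fin N → ℝ) : rexp ((∑ j, x j ^ 2) / 4) = ∏ j, rexp (x j ^ 2 / 4) := by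
  rw [← Real.exp_sum, Finset.sum_div]

lemma pi_sq_integrable : Integrable (fun x : Fin N → ℝ => rexp ((∑ j, x j ^ 2) / 4)) (bgPi θ N) := by
  simp_rw [pi_sq_eq]
  exact Integrable.fintype_prod (f := fun _ x => rexp (x ^ 2 / 4))
    (fun _ => bg_integrable gauss_sq_integrable)

lemma pi_sq_integral (h0 : 0 ≤ θ) (h1 : θ ≤ 1) :
    ∫ x, rexp ((∑ j, x j ^ 2) / 4) ∂ bgPi θ N ≤ rexp (θ * N) := by
  simp_rw [pi_sq_eq]
  unfold bgPi
  rw [integral_fintype_prod_eq_pow (fun x : ℝ => rexp (x ^ 2 / 4)), mul_comm θ, Real.exp_nat_mul]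
  simp only [Fintype.card_fin]
  exact pow_le_pow_left₀ (integral_nonneg fun x => (Real.exp_pos _).le) (bg_sq_integral h0 h1) _

lemma pi_lin_integrable (d : Fin N → ℝ) :
    Integrable (fun x : Fin N → ℝ => rexp (∑ j, d j * x j)) (bgPi θ N) := by
  simp_rw [Real.exp_sum]
  exact Integrable.fintype_prod (f := fun j x => rexp (d j * x))
    (fun j => bg_integrable (integrable_exp_mul_gaussianReal (d j)))

lemma pi_lin_integral (h0 : 0 ≤ θ) (h1 : θ ≤ 1) (d : Fin N → ℝ) (hd : ∑ j, d j ^ 2 ≤ 1) :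
    ∫ x, rexp (∑ j, d j * x j) ∂ bgPi θ N ≤ 1 + 2 * θ := by
  simp_rw [Real.exp_sum]
  unfold bgPi
  rw [integral_fintype_prod_eq_prod (fun j x => rexp (d j * x))]
  have hle : ∀ j, ∫ x, rexp (d j * x) ∂ bgMeasure θ ≤ rexp (θ * d j ^ 2) := by
    intro j
    rw [bg_exp_integral h0 h1]
    have hj : d j ^ 2 ≤ 1 :=
      (Finset.single_le_sum (fun i _ => sq_nonneg (d i)) (Finset.mem_univ j)).trans hd
    have hs := sq_nonneg (d j)
    have h3 := Real.abs_exp_sub_one_sub_id_le (x := d j ^ 2 / 2)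
      (by rw [abs_of_nonneg (by positivity)]; linarith)
    have h4 := (abs_le.1 h3).2
    have h5 : rexp (d j ^ 2 / 2) - 1 ≤ d j ^ 2 := by nlinarith
    have := Real.add_one_le_exp (θ * d j ^ 2)
    nlinarith
  calc _ ≤ ∏ j, rexp (θ * d j ^ 2) :=
        Finset.prod_le_prod (fun j _ => integral_nonneg fun x => (Real.exp_pos _).le)
          (fun j _ => hle j)
    _ = rexp (θ * ∑ j, d j ^ 2) := by rw [← Real.exp_sum, Finset.mul_sum]
    _ ≤ rexp θ := Real.exp_le_exp.2 (by nlinarith)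
    _ ≤ 1 + 2 * θ := by
      have h3 := (abs_le.1 (Real.abs_exp_sub_one_sub_id_le (x := θ)
        (by rwa [abs_of_nonneg h0]))).2
      nlinarith

lemma pi_six (h0 : 0 ≤ θ) (h1 : θ ≤ 1) (d : Fin N → ℝ) (hd : ∑ j, d j ^ 2 ≤ 1) :
    Integrable (fun x : Fin N → ℝ => (∑ j, d j * x j) ^ 6) (bgPi θ N) ∧
    ∫ x, (∑ j, d j * x j) ^ 6 ∂ bgPi θ N ≤ 1440 * θ := by
  have := bgPi_prob (N := N) h0 h1
  have i1 := pi_lin_integrable (θ := θ) d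
  have i2 := pi_lin_integrable (θ := θ) (-d)
  have l1 := pi_lin_integral h0 h1 d hd
  have l2 := pi_lin_integral h0 h1 (-d) (by simpa using hd)
  simp only [Pi.neg_apply, neg_mul, Finset.sum_neg_distrib] at i2 l2
  have key : ∀ x : Fin N → ℝ, (∑ j, d j * x j) ^ 6 ≤
      360 * (rexp (∑ j, d j * x j) + rexp (-∑ j, d j * x j)) - 720 := by
    intro x
    have := six_le_cosh (∑ j, d j * x j)
    rw [Real.cosh_eq] at this
    linarith
  have ii : Integrable (fun x : Fin N → ℝ =>
      360 * (rexp (∑ j, d j * x j) + rexp (-∑ j, d j * x j)) - 720) (bgPi θ N) :=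
    ((i1.add i2).const_mul 360).sub (integrable_const 720)
  have i6 : Integrable (fun x : Fin N → ℝ => (∑ j, d j * x j) ^ 6) (bgPi θ N) := by
    refine ii.mono' (Measurable.aestronglyMeasurable (by fun_prop)) (ae_of_all _ fun x => ?_)
    rw [Real.norm_of_nonneg (by positivity)]
    exact key x
  refine ⟨i6, (integral_mono i6 ii key).trans ?_⟩
  have i3 : Integrable (fun x : Fin N → ℝ =>
      360 * (rexp (∑ j, d j * x j) + rexp (-∑ j, d j * x j))) (bgPi θ N) :=
    (i1.add i2).const_mul 360
  rw [integral_sub i3 (integrable_const 720), integral_const_mul, integral_add i1 i2]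
  simp
  linarith

end

/-- truncated cubic -/
noncomputable def trunc {N : ℕ} (r : ℝ) (d x : Fin N → ℝ) : ℝ :=
  Set.indicator {x : Fin N → ℝ | ∑ j, x j ^ 2 ≤ r ^ 2} (fun x => |∑ j, d j * x j| ^ 3) x

section
variable {θ : ℝ} {N : ℕ}

lemma trunc_meas (r : ℝ) (d : Fin N → ℝ) : Measurable (trunc r d) := by
  unfold trunc
  refine Measurable.indicator (by fun_prop) ?_
  exact measurableSet_le (by fun_prop) (by fun_prop)

lemma dot_sq_le (d x : Fin N → ℝ) : (∑ j, d j * x j) ^ 2 ≤ (∑ j, d j ^ 2) * ∑ j, x j ^ 2 :=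
  Finset.sum_mul_sq_le_sq_mul_sq _ _ _

lemma dot_abs_le {r e : ℝ} (hr : 0 ≤ r) (he : 0 ≤ e) (d x : Fin N → ℝ) (hd : ∑ j, d j ^ 2 ≤ e ^ 2)
    (hx : ∑ j, x j ^ 2 ≤ r ^ 2) : |∑ j, d j * x j| ≤ e * r := by
  apply abs_le_of_sq_le_sq _ (by positivity)
  refine (dot_sq_le d x).trans ?_
  rw [mul_pow]
  have h1 : 0 ≤ ∑ j, x j ^ 2 := Finset.sum_nonneg fun i _ => sq_nonneg _
  gcongr

lemma trunc_nonneg (r : ℝ) (d x : Fin N → ℝ) : 0 ≤ trunc r d x :=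
  Set.indicator_nonneg (fun _ _ => by positivity) _

lemma trunc_le {r : ℝ} (hr : 0 ≤ r) (d x : Fin N → ℝ) (hd : ∑ j, d j ^ 2 ≤ 1) :
    trunc r d x ≤ r ^ 3 := by
  unfold trunc
  refine Set.indicator_apply_le' (fun hx => ?_) (fun _ => by positivity)
  have := dot_abs_le hr zero_le_one d x (by simpa using hd) hx
  rw [one_mul] at this
  gcongr

lemma cube_lip {r a b : ℝ} (ha : |a| ≤ r) (hb : |b| ≤ r) :
    |(|a| ^ 3 - |b| ^ 3)| ≤ 3 * r ^ 2 * |a - b| := by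
  have h : |a| ^ 3 - |b| ^ 3 = (|a| ^ 2 + |a| * |b| + |b| ^ 2) * (|a| - |b|) := by ring
  have h1 := abs_nonneg a
  have h2 := abs_nonneg b
  rw [h, abs_mul, abs_of_nonneg (by positivity)]
  have h3 := abs_abs_sub_abs_le a b
  have : |a| ^ 2 + |a| * |b| + |b| ^ 2 ≤ 3 * r ^ 2 := by nlinarith
  gcongr

lemma trunc_lip {r e : ℝ} (hr : 0 ≤ r) (he : 0 ≤ e) (d d' x : Fin N → ℝ) (hd : ∑ j, d j ^ 2 ≤ 1)
    (hd' : ∑ j, d' j ^ 2 ≤ 1) (hdd : ∑ j, (d j - d' j) ^ 2 ≤ e ^ 2) :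
    |trunc r d x - trunc r d' x| ≤ 3 * r ^ 3 * e := by
  unfold trunc
  by_cases hx : x ∈ {x : Fin N → ℝ | ∑ j, x j ^ 2 ≤ r ^ 2}
  · rw [Set.indicator_of_mem hx, Set.indicator_of_mem hx]
    have h1 := dot_abs_le hr zero_le_one d x (by simpa using hd) hx
    have h2 := dot_abs_le hr zero_le_one d' x (by simpa using hd') hx
    have h3 := dot_abs_le hr he (fun j => d j - d' j) x hdd hx
    rw [one_mul] at h1 h2
    refine (cube_lip h1 h2).trans ?_
    have h4 : ∑ j, d j * x j - ∑ j, d' j * x j = ∑ j, (d j - d' j) * x j := by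
      rw [← Finset.sum_sub_distrib]; exact Finset.sum_congr rfl fun j _ => by ring
    rw [h4]
    calc _ ≤ 3 * r ^ 2 * (e * r) := by gcongr
      _ = _ := by ring
  · rw [Set.indicator_of_notMem hx, Set.indicator_of_notMem hx]
    simp; positivity

lemma trunc_integrable (h0 : 0 ≤ θ) (h1 : θ ≤ 1) {r : ℝ} (hr : 0 ≤ r) (d : Fin N → ℝ)
    (hd : ∑ j, d j ^ 2 ≤ 1) : Integrable (trunc r d) (bgPi θ N) := by
  have := bgPi_prob (N := N) h0 h1
  refine (integrable_const (r ^ 3)).mono' (trunc_meas r d).aestronglyMeasurable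
    (ae_of_all _ fun x => ?_)
  rw [Real.norm_of_nonneg (trunc_nonneg _ _ _)]
  exact trunc_le hr d x hd

lemma trunc_sq (h0 : 0 ≤ θ) (h1 : θ ≤ 1) {r : ℝ} (d : Fin N → ℝ)
    (hd : ∑ j, d j ^ 2 ≤ 1) : ∫ x, trunc r d x ^ 2 ∂ bgPi θ N ≤ 1440 * θ := by
  obtain ⟨i6, h6⟩ := pi_six h0 h1 d hd
  have hle : ∀ x, trunc r d x ^ 2 ≤ (∑ j, d j * x j) ^ 6 := by
    intro x
    have h : (∑ j, d j * x j) ^ 6 = (|∑ j, d j * x j| ^ 3) ^ 2 := by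
      rw [← pow_mul]; exact (Even.pow_abs (by decide) _).symm
    rw [h]
    refine pow_le_pow_left₀ (trunc_nonneg _ _ _) ?_ 2
    exact Set.indicator_le_self' (fun _ _ => by positivity) _
  refine (integral_mono_of_nonneg (ae_of_all _ fun x => sq_nonneg _) i6 (ae_of_all _ hle)).trans h6

lemma cube_exp {a s : ℝ} (h : a ^ 2 ≤ s) : a ^ 3 ≤ 129 * rexp (s / 8) := by
  have hs : 0 ≤ s := (sq_nonneg a).trans h
  have h1 := Real.quadratic_le_exp_of_nonneg (x := s / 8) (by positivity)
  have h2 : a ^ 3 ≤ 1 + a ^ 4 := by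
    nlinarith [sq_nonneg (a ^ 2 - a), sq_nonneg (a - 1), sq_nonneg (a^2 - 1)]
  have h3 : a ^ 4 ≤ s ^ 2 := by nlinarith [sq_nonneg a]
  nlinarith

lemma bias (h0 : 0 ≤ θ) (h1 : θ ≤ 1) {r : ℝ} (hr : 0 ≤ r) (d : Fin N → ℝ)
    (hd : ∑ j, d j ^ 2 ≤ 1) :
    |popF θ N d + ∫ x, trunc r d x ∂ bgPi θ N| ≤ 129 * rexp (θ * N - r ^ 2 / 8) := by
  have := bgPi_prob (N := N) h0 h1
  have iq := pi_sq_integrable (θ := θ) (N := N)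
  have hq := pi_sq_integral (N := N) h0 h1
  have hb : ∀ x : Fin N → ℝ, |∑ j, d j * x j| ^ 3 ≤ 129 * rexp ((∑ j, x j ^ 2) / 8) := by
    intro x
    refine cube_exp ?_
    rw [sq_abs]
    have := dot_sq_le d x
    have h1 : 0 ≤ ∑ j, x j ^ 2 := Finset.sum_nonneg fun i _ => sq_nonneg _
    nlinarith
  have i3 : Integrable (fun x : Fin N → ℝ => |∑ j, d j * x j| ^ 3) (bgPi θ N) := by
    refine (iq.const_mul 129).mono' (Measurable.aestronglyMeasurable (by fun_prop))
      (ae_of_all _ fun x => ?_)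
    rw [Real.norm_of_nonneg (by positivity)]
    refine (hb x).trans ?_
    have h1 : 0 ≤ ∑ j, x j ^ 2 := Finset.sum_nonneg fun i _ => sq_nonneg _
    gcongr
    norm_num
  have it := trunc_integrable h0 h1 hr d hd
  have heq : popF θ N d + ∫ x, trunc r d x ∂ bgPi θ N =
      ∫ x, (-|∑ j, d j * x j| ^ 3 + trunc r d x) ∂ bgPi θ N := by
    exact (integral_add i3.neg it).symm
  rw [heq]
  have hpt : ∀ x : Fin N → ℝ, ‖-|∑ j, d j * x j| ^ 3 + trunc r d x‖ ≤
      129 * rexp (-(r ^ 2 / 8)) * rexp ((∑ j, x j ^ 2) / 4) := by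
    intro x
    unfold trunc
    by_cases hx : x ∈ {x : Fin N → ℝ | ∑ j, x j ^ 2 ≤ r ^ 2}
    · rw [Set.indicator_of_mem hx]
      simp; positivity
    · rw [Set.indicator_of_notMem hx, add_zero, norm_neg, Real.norm_of_nonneg (by positivity)]
      refine (hb x).trans ?_
      rw [mul_assoc, ← Real.exp_add]
      have : r ^ 2 < ∑ j, x j ^ 2 := by simpa using hx
      gcongr
      linarith
  rw [← Real.norm_eq_abs]
  refine (norm_integral_le_of_norm_le (iq.const_mul _) (ae_of_all _ hpt)).trans ?_
  rw [integral_const_mul, show θ * N - r ^ 2 / 8 = -(r ^ 2 / 8) + θ * N by ring, Real.exp_add,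
    ← mul_assoc]
  gcongr

lemma tail (h0 : 0 ≤ θ) (h1 : θ ≤ 1) (r : ℝ) :
    bgPi θ N {x | r ^ 2 < ∑ j, x j ^ 2} ≤ ENNReal.ofReal (rexp (θ * N - r ^ 2 / 4)) := by
  have := bgPi_prob (N := N) h0 h1
  have iq := pi_sq_integrable (θ := θ) (N := N)
  have hq := pi_sq_integral (N := N) h0 h1
  have h := mul_meas_ge_le_integral_of_nonneg (ae_of_all _ fun x => (Real.exp_pos _).le) iq
    (rexp (r ^ 2 / 4))
  rw [← ofReal_measureReal]
  apply ENNReal.ofReal_le_ofReal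
  have hm : (bgPi θ N).real {x | r ^ 2 < ∑ j, x j ^ 2} ≤
      (bgPi θ N).real {x | rexp (r ^ 2 / 4) ≤ rexp ((∑ j, x j ^ 2) / 4)} := by
    refine measureReal_mono fun x hx => ?_
    simp only [Set.mem_ofPred_eq, Real.exp_le_exp] at hx ⊢
    linarith
  have h2 := h.trans hq
  rw [Real.exp_sub, le_div_iff₀ (Real.exp_pos _), mul_comm]
  refine le_trans ?_ h2
  gcongr

end

lemma bern_one {Ω : Type*} [MeasurableSpace Ω] (P : Measure Ω) [IsProbabilityMeasure P] (L : ℕ)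
    (h : Ω → ℝ) (hm : Measurable h) {R V t l : ℝ} (hR : ∀ x, |h x| ≤ R)
    (hV : ∫ x, h x ^ 2 ∂P ≤ V) (hl : 0 ≤ l) (hlR : l * R ≤ 1) :
    (Measure.pi fun _ : Fin L => P) {ω | L * (∫ x, h x ∂P) + L * t ≤ ∑ i, h (ω i)} ≤
      ENNReal.ofReal (rexp (L * (l ^ 2 * V - l * t))) := by
  have hint : Integrable h P := (integrable_const R).mono' hm.aestronglyMeasurable
    (ae_of_all _ fun x => by simpa using hR x)
  have hint2 : Integrable (fun x => h x ^ 2) P := (integrable_const (R ^ 2)).mono'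
    (hm.pow_const 2).aestronglyMeasurable
    (ae_of_all _ fun x => by
      rw [Real.norm_of_nonneg (sq_nonneg _), ← sq_abs]
      exact pow_le_pow_left₀ (abs_nonneg _) (hR x) 2)
  set m := ∫ x, h x ∂P with hmdef
  have hpt : ∀ x, rexp (l * h x) ≤ 1 + l * h x + l ^ 2 * h x ^ 2 := by
    intro x
    have h1 : |l * h x| ≤ 1 := by
      rw [abs_mul, abs_of_nonneg hl]
      exact (mul_le_mul_of_nonneg_left (hR x) hl).trans hlR
    have := (abs_le.1 (Real.abs_exp_sub_one_sub_id_le h1)).2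
    nlinarith
  have hie : Integrable (fun x => rexp (l * h x)) P := by
    refine (integrable_const (rexp 1)).mono' (by fun_prop) (ae_of_all _ fun x => ?_)
    rw [Real.norm_of_nonneg (Real.exp_pos _).le]
    apply Real.exp_le_exp.2
    exact (mul_le_mul_of_nonneg_left ((le_abs_self _).trans (hR x)) hl).trans hlR
  have hi1 : Integrable (fun x => 1 + l * h x) P := (integrable_const 1).add (hint.const_mul l)
  have hE : ∫ x, rexp (l * h x) ∂P ≤ rexp (l * m + l ^ 2 * V) := by
    refine (integral_mono hie (hi1.add (hint2.const_mul (l ^ 2))) hpt).trans ?_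
    simp only [Pi.add_apply]
    rw [integral_add hi1 (hint2.const_mul (l ^ 2)), integral_add (integrable_const 1)
      (hint.const_mul l), integral_const_mul, integral_const_mul]
    have := Real.add_one_le_exp (l * m + l ^ 2 * V)
    have := mul_le_mul_of_nonneg_left hV (sq_nonneg l)
    simp; linarith
  have hI : Integrable (fun ω : Fin L → Ω => ∏ i, rexp (l * h (ω i)))
      (Measure.pi fun _ : Fin L => P) :=
    Integrable.fintype_prod (f := fun _ x => rexp (l * h x)) (fun _ => hie)
  have hM := mul_meas_ge_le_integral_of_nonneg (ae_of_all _ fun ω =>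
    Finset.prod_nonneg fun i _ => (Real.exp_pos _).le) hI (rexp (l * (L * m + L * t)))
  rw [integral_fintype_prod_eq_pow (fun x => rexp (l * h x)), Fintype.card_fin] at hM
  have hE' : (∫ x, rexp (l * h x) ∂P) ^ L ≤ rexp (L * (l * m + l ^ 2 * V)) := by
    rw [Real.exp_nat_mul]
    exact pow_le_pow_left₀ (integral_nonneg fun x => (Real.exp_pos _).le) hE L
  rw [← ofReal_measureReal]
  apply ENNReal.ofReal_le_ofReal
  have hmono : (Measure.pi fun _ : Fin L => P).real {ω | L * m + L * t ≤ ∑ i, h (ω i)} ≤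
      (Measure.pi fun _ : Fin L => P).real
        {ω | rexp (l * (L * m + L * t)) ≤ ∏ i, rexp (l * h (ω i))} := by
    refine measureReal_mono fun ω hω => ?_
    simp only [Set.mem_ofPred_eq] at hω ⊢
    rw [← Real.exp_sum, Real.exp_le_exp, ← Finset.mul_sum]
    gcongr
  rw [show L * (l ^ 2 * V - l * t) = L * (l * m + l ^ 2 * V) - l * (L * m + L * t) by ring,
    Real.exp_sub, le_div_iff₀ (Real.exp_pos _), mul_comm]
  refine le_trans ?_ (hM.trans hE')
  gcongr

lemma bern_s9 {Ω : Type*} [MeasurableSpace Ω] (P : Measure Ω) [IsProbabilityMeasure P] (L : ℕ)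
    (h : Ω → ℝ) (hm : Measurable h) {R V t l : ℝ} (hR : ∀ x, |h x| ≤ R)
    (hV : ∫ x, h x ^ 2 ∂P ≤ V) (hl : 0 ≤ l) (hlR : l * R ≤ 1) :
    (Measure.pi fun _ : Fin L => P) {ω | L * t ≤ |∑ i, h (ω i) - L * (∫ x, h x ∂P)|} ≤
      ENNReal.ofReal (2 * rexp (L * (l ^ 2 * V - l * t))) := by
  have a := bern_one P L h hm (t := t) hR hV hl hlR
  have b := bern_one P L (fun x => -h x) hm.neg (V := V) (t := t) (fun x => by simpa using hR x)
    (by simpa using hV) hl hlR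
  rw [two_mul, ENNReal.ofReal_add (Real.exp_pos _).le (Real.exp_pos _).le]
  refine le_trans ?_ (add_le_add a b)
  refine le_trans (measure_mono fun ω hω => ?_) (measure_union_le _ _)
  simp only [Set.mem_ofPred_eq, Set.mem_union, integral_neg, Finset.sum_neg_distrib] at hω ⊢
  rcases le_abs.1 hω with h | h
  · left; linarith
  · right; linarith

lemma round_exists (m : ℕ) (hm : 0 < m) (a : ℝ) (ha : a ^ 2 ≤ 1) :
    ∃ k ∈ Finset.Icc (-(m : ℤ)) m, ((k : ℝ) / m) ^ 2 ≤ a ^ 2 ∧ (a - k / m) ^ 2 ≤ 1 / (m : ℝ) ^ 2 := by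
  have hm' : (0 : ℝ) < m := by exact_mod_cast hm
  have habs : |a| ≤ 1 := by
    have := (sq_le_one_iff_abs_le_one a).1 ha
    exact this
  have h1 := Int.floor_le (m * |a|)
  have h2 := Int.lt_floor_add_one (m * |a|)
  have h0 : 0 ≤ ⌊m * |a|⌋ := Int.floor_nonneg.2 (by positivity)
  have hle : ⌊m * |a|⌋ ≤ m := by
    have : (⌊m * |a|⌋ : ℝ) ≤ m := h1.trans (by nlinarith)
    exact_mod_cast this
  have h0' : (0 : ℝ) ≤ ⌊m * |a|⌋ := by exact_mod_cast h0
  have e1 : ((⌊m * |a|⌋ : ℝ) / m) ≤ |a| := by rw [div_le_iff₀ hm']; linarith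
  have e2 : |a| - ((⌊m * |a|⌋ : ℝ) / m) ≤ 1 / m := by
    rw [sub_le_iff_le_add, ← add_div, le_div_iff₀ hm']; linarith
  have e3 : 0 ≤ ((⌊m * |a|⌋ : ℝ) / m) := by positivity
  rcases le_total 0 a with h | h
  · refine ⟨⌊m * |a|⌋, Finset.mem_Icc.2 ⟨by omega, hle⟩, ?_, ?_⟩
    · rw [← sq_abs a]; exact pow_le_pow_left₀ e3 e1 2
    · rw [← one_div_pow]
      rw [abs_of_nonneg h] at e1 e2 ⊢
      exact pow_le_pow_left₀ (by linarith) e2 2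
  · refine ⟨-⌊m * |a|⌋, Finset.mem_Icc.2 ⟨by omega, by omega⟩, ?_, ?_⟩
    · rw [← sq_abs a]; push_cast; rw [neg_div, neg_sq]; exact pow_le_pow_left₀ e3 e1 2
    · rw [← one_div_pow]; push_cast
      rw [abs_of_nonpos h] at e1 e2 ⊢
      rw [show (a - -(⌊m * -a⌋ : ℝ) / m) ^ 2 = (-a - (⌊m * -a⌋ : ℝ) / m) ^ 2 by ring]
      exact pow_le_pow_left₀ (by linarith) e2 2

lemma net_exists (N m : ℕ) (hm : 0 < m) :
    ∃ S : Finset (Fin N → ℝ), S.card ≤ (2 * m + 1) ^ N ∧ (∀ d ∈ S, ∑ j, d j ^ 2 ≤ 1) ∧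
      ∀ d : Fin N → ℝ, ∑ j, d j ^ 2 = 1 →
        ∃ d' ∈ S, ∑ j, (d j - d' j) ^ 2 ≤ (N : ℝ) / (m : ℝ) ^ 2 := by
  classical
  refine ⟨((Fintype.piFinset fun _ : Fin N => Finset.Icc (-(m : ℤ)) m).image
    (fun k j => (k j : ℝ) / m)).filter (fun d => ∑ j, d j ^ 2 ≤ 1), ?_, ?_, ?_⟩
  · refine (Finset.card_filter_le _ _).trans (Finset.card_image_le.trans ?_)
    rw [Fintype.card_piFinset]
    simp only [Int.card_Icc, Finset.prod_const, Finset.card_univ, Fintype.card_fin]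
    apply le_of_eq
    congr 1
    omega
  · intro d hd
    exact (Finset.mem_filter.1 hd).2
  · intro d hd
    have hj : ∀ j, d j ^ 2 ≤ 1 := fun j => by
      rw [← hd]
      exact Finset.single_le_sum (f := fun i => d i ^ 2) (fun i _ => sq_nonneg (d i))
        (Finset.mem_univ j)
    choose k hk1 hk2 hk3 using fun j => round_exists m hm (d j) (hj j)
    refine ⟨fun j => (k j : ℝ) / m, ?_, ?_⟩
    · refine Finset.mem_filter.2 ⟨Finset.mem_image.2 ⟨k, Fintype.mem_piFinset.2 hk1, rfl⟩, ?_⟩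
      rw [← hd]
      exact Finset.sum_le_sum fun j _ => hk2 j
    · refine (Finset.sum_le_sum fun j _ => hk3 j).trans ?_
      simp [div_eq_mul_inv]

lemma core {N L m : ℕ} {θ δ r e : ℝ} (h0 : 0 < θ) (h1 : θ ≤ 1) (hL : 0 < L) (hm : 0 < m)
    (hr : 0 ≤ r) (hδ : 0 < δ) (he : 0 ≤ e)
    (hR : δ * r ^ 3 ≤ θ)
    (hbias : 129 * rexp (θ * N - r ^ 2 / 8) ≤ δ / 4)
    (hme : (N : ℝ) / (m : ℝ) ^ 2 ≤ e ^ 2)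
    (hnet : 6 * r ^ 3 * e ≤ δ / 2)
    (htail : L * rexp (θ * N - r ^ 2 / 4) ≤ 1 / (2 * L))
    (hbern : (2 * m + 1 : ℝ) ^ N * (2 * rexp (-(L * δ ^ 2 / (92160 * θ)))) ≤ 1 / (2 * L)) :
    bgSamples θ N L
            {ω | ∀ d : Fin N → ℝ, ∑ i, d i ^ 2 = 1 →
              |empF N L ω d - popF θ N d| ≤ δ} ≥
          ENNReal.ofReal (1 - 1 / (L : ℝ)) := by
  have hP := bgPi_prob (N := N) h0.le h1
  have hPL : IsProbabilityMeasure (bgSamples θ N L) := by unfold bgSamples; infer_instance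
  have hL' : (0 : ℝ) < L := by exact_mod_cast hL
  obtain ⟨S, hS1, hS2, hS3⟩ := net_exists N m hm
  set E : Set (Fin L → Fin N → ℝ) := {ω | ∀ d : Fin N → ℝ, ∑ i, d i ^ 2 = 1 →
              |empF N L ω d - popF θ N d| ≤ δ} with hE
  let A : Fin L → Set (Fin L → Fin N → ℝ) := fun i => {ω | r ^ 2 < ∑ j, ω i j ^ 2}
  let B : (Fin N → ℝ) → Set (Fin L → Fin N → ℝ) := fun d =>
    {ω | L * (δ / 4) ≤ |∑ i, trunc r d (ω i) - L * ∫ x, trunc r d x ∂ bgPi θ N|}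
  have hA : ∀ i, bgSamples θ N L (A i) ≤ ENNReal.ofReal (rexp (θ * N - r ^ 2 / 4)) := by
    intro i
    refine le_trans (le_of_eq ?_) (tail h0.le h1 r)
    have hms : MeasurableSet {x : Fin N → ℝ | r ^ 2 < ∑ j, x j ^ 2} :=
      measurableSet_lt (by fun_prop) (by fun_prop)
    exact (measurePreserving_eval (fun _ : Fin L => bgPi θ N) i).measure_preimage
      hms.nullMeasurableSet
  have hB : ∀ d ∈ S, bgSamples θ N L (B d) ≤
      ENNReal.ofReal (2 * rexp (-(L * δ ^ 2 / (92160 * θ)))) := by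
    intro d hd
    have hb := bern_s9 (bgPi θ N) L (trunc r d) (trunc_meas r d) (R := r ^ 3) (V := 1440 * θ)
      (t := δ / 4) (l := δ / (11520 * θ))
      (fun x => by
        rw [abs_of_nonneg (trunc_nonneg _ _ _)]
        exact trunc_le hr d x (hS2 d hd))
      (trunc_sq h0.le h1 d (hS2 d hd)) (by positivity)
      (by rw [div_mul_eq_mul_div, div_le_one (by positivity)]; linarith)
    refine hb.trans (le_of_eq ?_)
    congr 3
    field_simp
    ring
  have hsub : Eᶜ ⊆ (⋃ i, A i) ∪ ⋃ d ∈ S, B d := by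
    intro ω hω
    by_contra hcon
    apply hω
    simp only [Set.mem_union, Set.mem_iUnion, not_or, not_exists] at hcon
    obtain ⟨hc1, hc2⟩ := hcon
    have hc1' : ∀ i, ∑ j, ω i j ^ 2 ≤ r ^ 2 := fun i => not_lt.1 (hc1 i)
    intro d hd
    obtain ⟨d', hd', hdd⟩ := hS3 d hd
    have hc2' : |∑ i, trunc r d' (ω i) - L * ∫ x, trunc r d' x ∂ bgPi θ N| < L * (δ / 4) :=
      not_le.1 (hc2 d' hd')
    have hdd' := hdd.trans hme
    have hemp : empF N L ω d = -(1 / L) * ∑ i, trunc r d (ω i) := by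
      unfold empF
      congr 1
      refine Finset.sum_congr rfl fun i _ => ?_
      unfold trunc
      have hi : ω i ∈ {x : Fin N → ℝ | ∑ j, x j ^ 2 ≤ r ^ 2} := hc1' i
      rw [Set.indicator_of_mem hi]
    have hbi := bias h0.le h1 hr d hd.le
    have l1 : |∑ i, trunc r d (ω i) - ∑ i, trunc r d' (ω i)| ≤ L * (3 * r ^ 3 * e) := by
      rw [← Finset.sum_sub_distrib]
      refine (Finset.abs_sum_le_sum_abs _ _).trans ?_
      refine (Finset.sum_le_sum fun i _ => trunc_lip hr he d d' (ω i) hd.le (hS2 d' hd') hdd').trans ?_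
      simp
    have l2 : |∫ x, trunc r d x ∂ bgPi θ N - ∫ x, trunc r d' x ∂ bgPi θ N| ≤ 3 * r ^ 3 * e := by
      rw [← integral_sub (trunc_integrable h0.le h1 hr d hd.le)
        (trunc_integrable h0.le h1 hr d' (hS2 d' hd')), ← Real.norm_eq_abs]
      refine (norm_integral_le_of_norm_le_const (C := 3 * r ^ 3 * e) (ae_of_all _ fun x => ?_)).trans ?_
      · exact trunc_lip hr he d d' x hd.le (hS2 d' hd') hdd'
      · simp
    rw [hemp]
    set s := ∑ i, trunc r d (ω i)
    set s' := ∑ i, trunc r d' (ω i)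
    set G := ∫ x, trunc r d x ∂ bgPi θ N
    set G' := ∫ x, trunc r d' x ∂ bgPi θ N
    set F := popF θ N d
    have hs : |s / L - G| ≤ 3 * δ / 4 := by
      have : |s - L * G| ≤ L * (3 * δ / 4) := by
        have hz : s - L * G = (s - s') + (s' - L * G') + L * (G' - G) := by ring
        have l3 : |L * (G' - G)| ≤ L * (3 * r ^ 3 * e) := by
          rw [abs_mul, abs_of_pos hL', abs_sub_comm]
          gcongr
        rw [hz]
        refine (abs_add_three _ _ _).trans ?_
        have := mul_le_mul_of_nonneg_left hnet hL'.le
        linarith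
      have hz : s / L - G = (s - L * G) / L := by field_simp
      rw [hz, abs_div, abs_of_pos hL', div_le_iff₀ hL']
      linarith
    have hz : -(1 / (L : ℝ)) * s - F = -(s / L - G) - (F + G) := by ring
    rw [hz]
    refine (abs_sub _ _).trans ?_
    rw [abs_neg]
    linarith
  have hcompl : bgSamples θ N L Eᶜ ≤ ENNReal.ofReal (1 / L) := by
    calc bgSamples θ N L Eᶜ ≤ bgSamples θ N L ((⋃ i, A i) ∪ ⋃ d ∈ S, B d) := measure_mono hsub
      _ ≤ bgSamples θ N L (⋃ i, A i) + bgSamples θ N L (⋃ d ∈ S, B d) := measure_union_le _ _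
      _ ≤ (∑ i, bgSamples θ N L (A i)) + ∑ d ∈ S, bgSamples θ N L (B d) :=
        add_le_add (measure_iUnion_fintype_le _ _) (measure_biUnion_finset_le _ _)
      _ ≤ (∑ i : Fin L, ENNReal.ofReal (rexp (θ * N - r ^ 2 / 4))) +
          ∑ d ∈ S, ENNReal.ofReal (2 * rexp (-(L * δ ^ 2 / (92160 * θ)))) :=
        add_le_add (Finset.sum_le_sum fun i _ => hA i) (Finset.sum_le_sum hB)
      _ = ENNReal.ofReal (L * rexp (θ * N - r ^ 2 / 4) +
          S.card * (2 * rexp (-(L * δ ^ 2 / (92160 * θ))))) := by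
        rw [ENNReal.ofReal_add (by positivity) (by positivity), ENNReal.ofReal_mul (by positivity),
          ENNReal.ofReal_mul (p := (S.card : ℝ)) (by positivity)]
        simp
      _ ≤ ENNReal.ofReal (1 / L) := by
        apply ENNReal.ofReal_le_ofReal
        have hc : (S.card : ℝ) ≤ (2 * m + 1 : ℝ) ^ N := by exact_mod_cast hS1
        have h3 : (S.card : ℝ) * (2 * rexp (-(L * δ ^ 2 / (92160 * θ)))) ≤ 1 / (2 * L) :=
          le_trans (by gcongr) hbern
        have : 1 / (L : ℝ) = 1 / (2 * L) + 1 / (2 * L) := by field_simp; norm_num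
        linarith
  have hone : 1 ≤ bgSamples θ N L E + ENNReal.ofReal (1 / L) := by
    refine le_trans ?_ (add_le_add_right hcompl _)
    rw [← measure_univ (μ := bgSamples θ N L), ← Set.union_compl_self E]
    exact measure_union_le _ _
  rw [ENNReal.ofReal_sub _ (by positivity), ENNReal.ofReal_one, ge_iff_le, tsub_le_iff_right]
  exact hone

set_option maxHeartbeats 4000000 in
/-- concentration of the empirical objective: there are absolute
constants c₁, C₁ > 0 such that for θ ∈ (1/N, 1/2), any
δ ∈ (0, c₁/(N log L log(NL) θ^{1/3})^{3/2}) and any L ≥ C₁ δ⁻² N θ log(Nθ/δ),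
with probability ≥ 1 − 1/L, sup_{d ∈ S^{N−1}} |f(d) − 𝔼[f(d)]| ≤ δ. -/
theorem stmt9 :
    ∃ c₁ > (0 : ℝ), ∃ C₁ > (0 : ℝ),
      ∀ (N L : ℕ) (θ δ : ℝ),
        1 / (N : ℝ) < θ → θ < 1 / 2 →
        0 < δ →
        δ < c₁ / ((N : ℝ) * Real.log L * Real.log (N * L) * θ ^ ((1 : ℝ) / 3))
              ^ ((3 : ℝ) / 2) →
        (L : ℝ) ≥ C₁ * δ⁻¹ ^ 2 * N * θ * Real.log ((N : ℝ) * θ / δ) →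
        bgSamples θ N L
            {ω | ∀ d : Fin N → ℝ, ∑ i, d i ^ 2 = 1 →
              |empF N L ω d - popF θ N d| ≤ δ} ≥
          ENNReal.ofReal (1 - 1 / (L : ℝ)) := by
  refine ⟨1 / 512, by norm_num, 184320 * (10 + 184320), by norm_num, ?_⟩
  intro N L θ δ hθ1 hθ2 hδ hδ2 hLge
  have hN0 : (0:ℝ) < N := by
    rcases Nat.eq_zero_or_pos N with rfl | h
    · norm_num at hδ2; linarith
    · exact_mod_cast h
  have hθ0 : 0 < θ := lt_trans (by positivity) hθ1
  have hNθ : 1 < N * θ := by rwa [div_lt_iff₀ hN0, mul_comm] at hθ1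
  have hN3 : (3:ℝ) ≤ N := by
    have : (2:ℝ) < N := by nlinarith
    have : 2 < N := by exact_mod_cast this
    exact_mod_cast this
  have hL2 : (2:ℝ) ≤ L := by
    have : 2 ≤ L := by
      by_contra hcon
      have : L = 0 ∨ L = 1 := by omega
      rcases this with rfl | rfl <;> norm_num at hδ2 <;> linarith
    exact_mod_cast this
  have hl2 := Real.log_two_gt_d9
  have hl : 1 / 2 ≤ Real.log L := by
    have := Real.log_le_log (by norm_num) hL2
    linarith
  have hlN : 1 ≤ Real.log (N * L) := by
    rw [Real.le_log_iff_exp_le (by positivity)]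
    have := Real.exp_one_lt_d9
    nlinarith
  set ℓ := Real.log L with hℓ
  set p := Real.log (N * L) with hp
  -- main smallness condition
  have hA : δ ^ 2 * (N ^ 3 * ℓ ^ 3 * p ^ 3 * θ) ≤ (1 / 512) ^ 2 := by
    have hq0 : (0:ℝ) < N * ℓ * p * θ ^ ((1 : ℝ) / 3) := by positivity
    have hq : ((N * ℓ * p * θ ^ ((1 : ℝ) / 3)) ^ ((3 : ℝ) / 2)) ^ 2 = N ^ 3 * ℓ ^ 3 * p ^ 3 * θ := by
      have e3 : (θ ^ ((1 : ℝ) / 3)) ^ 3 = θ := by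
        rw [← Real.rpow_natCast, ← Real.rpow_mul hθ0.le]; norm_num
      rw [← Real.rpow_natCast (_ ^ ((3:ℝ)/2)) 2, ← Real.rpow_mul hq0.le,
        show (3:ℝ) / 2 * (2:ℕ) = (3:ℕ) by norm_num, Real.rpow_natCast, mul_pow, e3]
      ring
    rw [← hq, ← mul_pow]
    rw [lt_div_iff₀ (by positivity)] at hδ2
    exact pow_le_pow_left₀ (by positivity) hδ2.le 2
  have hδN : δ * N ≤ 1 := by
    have h8 : (1 / 2) ^ 3 ≤ ℓ ^ 3 := pow_le_pow_left₀ (by norm_num) hl 3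
    have hp3 : 1 ≤ p ^ 3 := one_le_pow₀ hlN
    have h9 : (1:ℝ) / 8 ≤ ℓ ^ 3 * p ^ 3 := by nlinarith
    have h10 : (N:ℝ) ^ 2 * (1 / 8) ≤ N ^ 3 * ℓ ^ 3 * p ^ 3 * θ := by
      calc (N:ℝ) ^ 2 * (1 / 8) ≤ (N ^ 2 * (N * θ)) * (ℓ ^ 3 * p ^ 3) := by
            gcongr
            nlinarith [sq_nonneg (N:ℝ)]
        _ = _ := by ring
    have h11 := mul_le_mul_of_nonneg_left h10 (sq_nonneg δ)
    have h12 : (δ * N) ^ 2 ≤ 1 := by nlinarith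
    exact (abs_le.1 ((sq_le_one_iff_abs_le_one _).1 h12)).2
  have hδ3 : δ ≤ 1 / 3 := by nlinarith
  set D := 1 / δ with hD
  have hD3 : 3 ≤ D := by rw [hD, le_div_iff₀ hδ]; linarith
  have hND : N ≤ D := by rw [hD, le_div_iff₀ hδ]; linarith
  set Λ := Real.log (N * θ / δ) with hΛ
  have hΛD : Real.log D ≤ Λ := by
    apply Real.log_le_log (by positivity)
    rw [hD]; gcongr
  have hΛ1 : 1 ≤ Λ := by
    refine le_trans ?_ hΛD
    rw [Real.le_log_iff_exp_le (by positivity)]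
    have := Real.exp_one_lt_d9
    linarith
  have hδD : δ * D = 1 := by rw [hD]; field_simp
  have hLX : 184320 * (10 + 184320) * (N * Λ) ≤ L * δ ^ 2 / θ := by
    rw [le_div_iff₀ hθ0]
    have : 184320 * (10 + 184320) * δ⁻¹ ^ 2 * N * θ * Λ * δ ^ 2 ≤ L * δ ^ 2 := by
      gcongr
    refine le_trans (le_of_eq ?_) this
    field_simp
  have hLD : D ^ 2 ≤ L := by
    have h1 : 1 ≤ L * δ ^ 2 := by
      rw [le_div_iff₀ hθ0] at hLX
      have : 1 ≤ N * Λ * θ := by nlinarith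
      linarith
    calc D ^ 2 = D ^ 2 * 1 := by ring
      _ ≤ D ^ 2 * (L * δ ^ 2) := by gcongr
      _ = L * (δ * D) ^ 2 := by ring
      _ = L := by rw [hδD]; ring
  have hDL : D ≤ L := by nlinarith [hLD, hD3]
  have hL9 : (9:ℝ) ≤ L := by nlinarith [hLD, hD3]
  have hl1 : 1 ≤ ℓ := by
    rw [hℓ, Real.le_log_iff_exp_le (by positivity)]
    have := Real.exp_one_lt_d9
    linarith
  have hexpl : rexp ℓ = L := Real.exp_log (by positivity)
  -- the truncation radius
  set T := N * θ * ℓ * p with hT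
  have hT0 : 0 < T := by positivity
  have hr2 : (8 * √T) ^ 2 = 64 * T := by rw [mul_pow, Real.sq_sqrt hT0.le]; norm_num
  have hTl : ℓ ≤ T - 0 ∧ θ * N ≤ T := by
    constructor
    · rw [hT, sub_zero]
      calc ℓ = 1 * ℓ * 1 := by ring
        _ ≤ (N * θ) * ℓ * p := by gcongr
    · calc θ * N = N * θ * 1 * 1 := by ring
        _ ≤ N * θ * ℓ * p := by gcongr
  have hR : δ * (8 * √T) ^ 3 ≤ θ := by
    refine (sq_le_sq₀ (by positivity) hθ0.le).1 ?_
    calc (δ * (8 * √T) ^ 3) ^ 2 = δ ^ 2 * ((8 * √T) ^ 2) ^ 3 := by ring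
      _ = 64 ^ 3 * θ ^ 2 * (δ ^ 2 * (N ^ 3 * ℓ ^ 3 * p ^ 3 * θ)) := by rw [hr2, hT]; ring
      _ ≤ 64 ^ 3 * θ ^ 2 * (1 / 512) ^ 2 := by gcongr
      _ = θ ^ 2 := by ring
  have hrD : (8 * √T) ^ 3 ≤ D := by
    rw [hD, le_div_iff₀ hδ]; linarith
  have hexp7 : rexp (θ * N - (8 * √T) ^ 2 / 8) ≤ 1 / (L:ℝ) ^ 7 := by
    rw [← hexpl, ← Real.exp_nat_mul, one_div, ← Real.exp_neg]
    apply Real.exp_le_exp.2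
    rw [hr2]; push_cast; linarith [hTl.1, hTl.2]
  have hLpos : (0:ℝ) < L := by positivity
  have hL6 : (9:ℝ) ^ 4 ≤ L ^ 4 := pow_le_pow_left₀ (by norm_num) hL9 4
  obtain ⟨m, hmdef⟩ : ∃ m : ℕ, m = ⌈12 * D ^ 3⌉₊ := ⟨_, rfl⟩
  have hm1 : 12 * D ^ 3 ≤ m := by rw [hmdef]; exact Nat.le_ceil _
  have hm2 : (m:ℝ) < 12 * D ^ 3 + 1 := by rw [hmdef]; exact Nat.ceil_lt_add_one (by positivity)
  have hmpos : (0:ℝ) < m := lt_of_lt_of_le (by positivity) hm1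
  refine core (m := m) (r := 8 * √T) (e := δ ^ 2 / 12) hθ0 (by linarith)
    (by exact_mod_cast hLpos) (by exact_mod_cast hmpos) (by positivity) hδ (by positivity) hR
    ?_ ?_ ?_ ?_ ?_
  · -- bias
    have h1 : 1 / (L:ℝ) ^ 7 ≤ δ / 516 := by
      rw [div_le_div_iff₀ (by positivity) (by norm_num), one_mul]
      have h2 : 1 ≤ δ * L := by
        calc 1 = δ * D := hδD.symm
          _ ≤ δ * L := mul_le_mul_of_nonneg_left hDL hδ.le
      calc (516:ℝ) ≤ 1 * 9 ^ 4 * 1 := by norm_num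
        _ ≤ (δ * L) * L ^ 4 * L ^ 2 := by
          gcongr
          exact one_le_pow₀ (by linarith)
        _ = δ * L ^ 7 := by ring
    linarith
  · -- net resolution
    rw [div_le_iff₀ (by positivity)]
    have h1 : (N:ℝ) ≤ δ ^ 2 / 12 * m := by
      calc (N:ℝ) ≤ D := hND
        _ = δ ^ 2 / 12 * (12 * D ^ 3) := by
          calc D = (δ * D) ^ 2 * D := by rw [hδD]; ring
            _ = _ := by ring
        _ ≤ _ := by gcongr
    rw [← mul_pow]
    nlinarith
  · calc 6 * (8 * √T) ^ 3 * (δ ^ 2 / 12) ≤ 6 * D * (δ ^ 2 / 12) := by gcongr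
      _ = (δ * D) * δ / 2 := by ring
      _ = δ / 2 := by rw [hδD]; ring
      _ ≤ δ / 2 := le_rfl
  · -- tail
    have h1 : rexp (θ * N - (8 * √T) ^ 2 / 4) ≤ 1 / (L:ℝ) ^ 7 := by
      refine le_trans (Real.exp_le_exp.2 ?_) hexp7
      have := sq_nonneg (8 * √T)
      linarith
    calc L * rexp (θ * N - (8 * √T) ^ 2 / 4) ≤ L * (1 / (L:ℝ) ^ 7) := by gcongr
      _ = 1 / (L * L ^ 5) := by field_simp
      _ ≤ 1 / (2 * L) := by
        apply one_div_le_one_div_of_le (by positivity)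
        have : (1:ℝ) ≤ L ^ 4 := one_le_pow₀ (by linarith)
        have h5 : (2:ℝ) ≤ L ^ 5 := by
          rw [pow_succ]; nlinarith
        nlinarith
  · -- union bound over the net
    set X := L * δ ^ 2 / θ with hX
    have hX0 : 0 < X := by positivity
    clear_value X
    have h2m : (2 * m + 1 : ℝ) ≤ D ^ 6 := by
      have h27 : (27:ℝ) ≤ D ^ 3 := by
        have := pow_le_pow_left₀ (by norm_num) hD3 3
        linarith
      have : D ^ 6 = D ^ 3 * D ^ 3 := by ring
      rw [this]; nlinarith
    have hD0 : 0 < D := by positivity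
    have hpow : (2 * m + 1 : ℝ) ^ N ≤ rexp (6 * (N * Λ)) := by
      calc (2 * m + 1 : ℝ) ^ N ≤ (D ^ 6) ^ N := by gcongr
        _ = rexp (6 * (N * Real.log D)) := by
          rw [show 6 * (N * Real.log D) = (N:ℝ) * ((6:ℕ) * Real.log D) by push_cast; ring,
            Real.exp_nat_mul, Real.exp_nat_mul, Real.exp_log hD0]
        _ ≤ _ := by gcongr
    have hNΛ : 1 ≤ N * Λ := by nlinarith
    have hℓX : ℓ ≤ X / 184320 + 184320 + 2 * (N * Λ) := by
      have hL_eq : (L:ℝ) = X * θ * D ^ 2 := by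
        have : X * θ = L * δ ^ 2 := by rw [hX]; field_simp
        rw [this]
        calc (L:ℝ) = L * (δ * D) ^ 2 := by rw [hδD]; ring
          _ = _ := by ring
      have h1 : ℓ = Real.log (X / 184320) + Real.log 184320 + Real.log θ + 2 * Real.log D := by
        rw [hℓ, hL_eq, Real.log_mul (by positivity) (by positivity),
          Real.log_mul (by positivity) (by positivity), Real.log_pow,
          Real.log_div hX0.ne' (by norm_num)]
        push_cast; ring
      have h2 := Real.log_le_sub_one_of_pos (x := X / 184320) (by positivity)
      have h3 := Real.log_le_sub_one_of_pos (x := (184320:ℝ)) (by norm_num)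
      have h4 : Real.log θ ≤ 0 := Real.log_nonpos hθ0.le (by linarith)
      have h5 : Λ ≤ N * Λ := by nlinarith
      linarith
    have h2e : (2:ℝ) ≤ rexp 1 := by have := Real.add_one_le_exp (1:ℝ); linarith
    have hXe : L * δ ^ 2 / (92160 * θ) = X / 92160 := by rw [hX]; field_simp
    rw [hXe, le_div_iff₀ (by positivity)]
    calc (2 * m + 1 : ℝ) ^ N * (2 * rexp (-(X / 92160))) * (2 * L)
        ≤ rexp (6 * (N * Λ)) * (rexp 1 * rexp (-(X / 92160))) * (rexp 1 * rexp ℓ) := by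
          rw [hexpl]; gcongr
      _ = rexp (6 * (N * Λ) + (1 + -(X / 92160)) + (1 + ℓ)) := by
          simp only [Real.exp_add]
      _ ≤ rexp 0 := by
          apply Real.exp_le_exp.2
          linarith
      _ = 1 := Real.exp_zero
end
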